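/- arXiv:1706.02408 — 11 statements merged into one kernel-verified Lean document; each statement's English description precedes it below -/
import Mathlib

section
/- Let T > 0, s₀, K ∈ ℝ, and let a : ℝ × [0,T] → ℝ be continuously differentiable with a(x,t) > 0 for all x ∈ ℝ, t ∈ [0,T]. Suppose s : [0,T] → ℝ is twice continuously differentiable, satisfies s(0) = s₀ and (1/T)∫₀ᵀ s(t) dt = K, and minimizes the functional F(y) = (1/2)∫₀ᵀ (ẏ(t)/a(y(t),t))² dt among all twice continuously differentiable paths y : [0,T] → ℝ with y(0) = s₀ and (1/T)∫₀ᵀ y(t) dt = K. Then ṡ(T) = 0 and there exists λ ∈ ℝ such that for all t ∈ [0,T] the Euler–Lagrange equation (d/dt)(ṡ(t)/a(s(t),t)) − (∂_t a(s(t),t)/a(s(t),t)²)·ṡ(t) + (λ/T)·a(s(t),t) = 0 holds. -/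
open Real intervalIntegral

/-- Differentiation under the integral sign for a jointly continuous parameter derivative. -/
theorem hasDerivAt_integral_of_continuousOn_deriv {T : ℝ} (hT : 0 ≤ T) {G G' : ℝ → ℝ → ℝ}
    (hG : ∀ x, ContinuousOn (G x) (Set.Icc 0 T))
    (hG' : ContinuousOn (fun p : ℝ × ℝ => G' p.1 p.2) (Set.univ ×ˢ Set.Icc 0 T))
    (hd : ∀ x, ∀ t ∈ Set.Icc 0 T, HasDerivAt (fun x => G x t) (G' x t) x) (x₀ : ℝ) :
    HasDerivAt (fun x => ∫ t in (0 : ℝ)..T, G x t) (∫ t in (0 : ℝ)..T, G' x₀ t) x₀ := by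
  have hsub : Set.uIoc 0 T ⊆ Set.Icc 0 T := by
    rw [Set.uIoc_of_le hT]; exact Set.Ioc_subset_Icc_self
  obtain ⟨C, hC⟩ := ((isCompact_closedBall x₀ 1).prod
    (isCompact_Icc (a := (0 : ℝ)) (b := T))).exists_bound_of_continuousOn
      (hG'.mono (Set.prod_mono_left (Set.subset_univ _)))
  have hG'x : ContinuousOn (G' x₀) (Set.Icc 0 T) :=
    hG'.comp (f := fun t => (x₀, t)) (by fun_prop) fun t ht => ⟨Set.mem_univ _, ht⟩
  refine (intervalIntegral.hasDerivAt_integral_of_dominated_loc_of_deriv_le (bound := fun _ => C)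
    (Metric.closedBall_mem_nhds x₀ one_pos) ?_ ?_ ?_ ?_ ?_ ?_).2
  · exact .of_forall fun x =>
      ((hG x).mono hsub).aestronglyMeasurable measurableSet_uIoc
  · exact (hG x₀).intervalIntegrable_of_Icc hT
  · exact (hG'x.mono hsub).aestronglyMeasurable measurableSet_uIoc
  · exact .of_forall fun t ht x hx => hC (x, t) ⟨hx, hsub ht⟩
  · exact intervalIntegrable_const
  · exact .of_forall fun t ht x _ => hd x t (hsub ht)

/-- A continuous function annihilating every twice continuously differentiable function that
vanishes at both endpoints and has zero mean is constant. -/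
theorem exists_const_of_integral_mul_eq_zero {T : ℝ} (hT : 0 < T) {g : ℝ → ℝ}
    (hg : ContinuousOn g (Set.Icc 0 T))
    (h : ∀ η : ℝ → ℝ, ContDiff ℝ 2 η → η 0 = 0 → η T = 0 → ∫ t in (0 : ℝ)..T, η t = 0 →
      ∫ t in (0 : ℝ)..T, η t * g t = 0) :
    ∃ c, ∀ t ∈ Set.Icc 0 T, g t = c := by
  set φ : ℝ → ℝ := fun t => 6 / T ^ 3 * (T * t - t ^ 2) with hφ
  have hφc : ContDiff ℝ 2 φ := by fun_prop
  have hφint : ∫ t in (0 : ℝ)..T, φ t = 1 := by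
    simp only [hφ, integral_const_mul]
    rw [integral_sub (Continuous.intervalIntegrable (by fun_prop) _ _)
      (Continuous.intervalIntegrable (by fun_prop) _ _), integral_const_mul]
    simp
    field_simp
    norm_num
  have hgi : ∀ η : ℝ → ℝ, Continuous η →
      IntervalIntegrable (fun t => η t * g t) MeasureTheory.volume 0 T := fun η hη =>
    (hη.continuousOn.mul hg).intervalIntegrable_of_Icc hT.le
  refine ⟨∫ t in (0 : ℝ)..T, φ t * g t, ?_⟩
  set c := ∫ t in (0 : ℝ)..T, φ t * g t
  refine MeasureTheory.Measure.eqOn_Icc_of_ae_eq (μ := MeasureTheory.volume) hT.ne ?_ hg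
    continuousOn_const
  rw [MeasureTheory.Measure.restrict_congr_set MeasureTheory.Ioo_ae_eq_Icc.symm]
  rw [Filter.EventuallyEq, MeasureTheory.ae_restrict_iff' measurableSet_Ioo]
  have key := isOpen_Ioo.ae_eq_zero_of_integral_contDiff_smul_eq_zero (U := Set.Ioo 0 T)
    (f := fun t => g t - c) (μ := MeasureTheory.volume)
    (((hg.sub continuousOn_const).mono Set.Ioo_subset_Icc_self).locallyIntegrableOn
      measurableSet_Ioo) ?_
  · filter_upwards [key] with t ht htm using sub_eq_zero.1 (ht htm)
  intro η hη _ hsupp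
  have hη0 : ∀ t, t ∉ Set.Ioo 0 T → η t = 0 := fun t ht =>
    image_eq_zero_of_notMem_tsupport fun hm => ht (hsupp hm)
  have hηc : Continuous η := hη.continuous
  have hset : ∫ t, η t • (g t - c) = ∫ t in (0 : ℝ)..T, η t * (g t - c) := by
    rw [integral_of_le hT.le]
    refine (MeasureTheory.setIntegral_eq_integral_of_forall_compl_eq_zero fun t ht => ?_).symm
    rw [hη0 t fun hm => ht (Set.Ioo_subset_Ioc_self hm), zero_smul]
  have hηφ := h (fun t => η t - (∫ t in (0 : ℝ)..T, η t) * φ t)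
    (by have : ContDiff ℝ 2 η := contDiff_infty.1 hη 2
        fun_prop)
    (by simp [hη0, hφ]) (by simp only [hφ]; rw [hη0 T (by simp)]; ring)
    (by rw [integral_sub (hηc.intervalIntegrable _ _)
          ((continuous_const.fun_mul hφc.continuous).intervalIntegrable _ _),
          integral_const_mul, hφint]; ring)
  rw [hset]
  simp only [sub_mul, mul_sub, mul_assoc] at hηφ ⊢
  rw [integral_sub (hgi η hηc) ((hgi φ hφc.continuous).const_mul _), integral_const_mul] at hηφ
  rw [integral_sub (hgi η hηc) ((hηc.intervalIntegrable _ _).mul_const _), integral_mul_const]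
  exact hηφ

/-- Natural boundary condition and multiplier rule for a linear functional
`η ↦ p * η(T) - ∫₀ᵀ η g` vanishing on zero-mean functions with `η(0) = 0`. -/
theorem eq_zero_and_exists_const_of_boundary_sub_integral_eq_zero {T p : ℝ} (hT : 0 < T)
    {g : ℝ → ℝ} (hg : ContinuousOn g (Set.Icc 0 T))
    (h : ∀ η : ℝ → ℝ, ContDiff ℝ 2 η → η 0 = 0 → ∫ t in (0 : ℝ)..T, η t = 0 →
      p * η T - ∫ t in (0 : ℝ)..T, η t * g t = 0) :
    p = 0 ∧ ∃ c, ∀ t ∈ Set.Icc 0 T, g t = c := by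
  obtain ⟨c, hc⟩ := exists_const_of_integral_mul_eq_zero hT hg fun η hη h0 hηT hi => by
    simpa [hηT] using h η hη h0 hi
  refine ⟨?_, c, hc⟩
  have hi : ∫ t in (0 : ℝ)..T, (3 * t ^ 2 - 2 * T * t) = 0 := by
    rw [integral_sub (Continuous.intervalIntegrable (by fun_prop) _ _)
      (Continuous.intervalIntegrable (by fun_prop) _ _), integral_const_mul, integral_const_mul]
    simp
    ring
  have hp := h (fun t => 3 * t ^ 2 - 2 * T * t) (by fun_prop) (by simp) hi
  rw [integral_congr (g := fun t => (3 * t ^ 2 - 2 * T * t) * c) fun t ht => by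
    rw [Set.uIcc_of_le hT.le] at ht
    simp only [hc t ht], integral_mul_const, hi] at hp
  have : p * T ^ 2 = 0 := by linear_combination hp
  simpa [hT.ne'] using this

/-- **Euler–Lagrange equation of the most-likely-path variational problem**: if a twice
continuously differentiable path `s` with `s(0) = s₀` and `(1/T)∫₀ᵀ s = K` minimizes the
action `F(y) = (1/2)∫₀ᵀ (ẏ/a(y,t))² dt` among all such paths, then `ṡ(T) = 0` and there
is a Lagrange multiplier `λ` such that
`(d/dt)(ṡ/a(s,t)) - (∂ₜa(s,t)/a(s,t)²) ṡ + (λ/T) a(s,t) = 0` on `[0,T]`. -/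
theorem euler_lagrange_most_likely_path (T s₀ K : ℝ) (hT : 0 < T)
    (a : ℝ → ℝ → ℝ) (ha : ContDiff ℝ 1 fun p : ℝ × ℝ => a p.1 p.2)
    (hapos : ∀ x : ℝ, ∀ t ∈ Set.Icc (0 : ℝ) T, 0 < a x t)
    (s : ℝ → ℝ) (hs : ContDiff ℝ 2 s)
    (hs0 : s 0 = s₀) (hsK : (1 / T) * ∫ t in (0 : ℝ)..T, s t = K)
    (hmin : ∀ y : ℝ → ℝ, ContDiff ℝ 2 y → y 0 = s₀ →
      (1 / T) * ∫ t in (0 : ℝ)..T, y t = K →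
      (1 / 2) * ∫ t in (0 : ℝ)..T, (deriv s t / a (s t) t) ^ 2 ≤
        (1 / 2) * ∫ t in (0 : ℝ)..T, (deriv y t / a (y t) t) ^ 2) :
    deriv s T = 0 ∧
    ∃ lam : ℝ, ∀ t ∈ Set.Icc (0 : ℝ) T,
      deriv (fun u => deriv s u / a (s u) u) t
        - deriv (fun τ => a (s t) τ) t / (a (s t) t) ^ 2 * deriv s t
        + lam / T * a (s t) t = 0 := by
  obtain ⟨ax, hax⟩ : ∃ f : ℝ → ℝ → ℝ, f = fun x t =>
    fderiv ℝ (fun p : ℝ × ℝ => a p.1 p.2) (x, t) (1, 0) := ⟨_, rfl⟩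
  obtain ⟨at', hat⟩ : ∃ f : ℝ → ℝ → ℝ, f = fun x t =>
    fderiv ℝ (fun p : ℝ × ℝ => a p.1 p.2) (x, t) (0, 1) := ⟨_, rfl⟩
  have hac : Continuous fun p : ℝ × ℝ => a p.1 p.2 := ha.continuous
  have haxc : Continuous fun p : ℝ × ℝ => ax p.1 p.2 := by
    rw [hax]; exact (ha.continuous_fderiv one_ne_zero).clm_apply continuous_const
  have hatc : Continuous fun p : ℝ × ℝ => at' p.1 p.2 := by
    rw [hat]; exact (ha.continuous_fderiv one_ne_zero).clm_apply continuous_const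
  have hchain : ∀ {u v : ℝ → ℝ} {u' v' t : ℝ}, HasDerivAt u u' t → HasDerivAt v v' t →
      HasDerivAt (fun r => a (u r) (v r)) (u' * ax (u t) (v t) + v' * at' (u t) (v t)) t := by
    intro u v u' v' t hu hv
    have h1 := ((ha.differentiable one_ne_zero) (u t, v t)).hasFDerivAt.comp_hasDerivAt t
      (hu.prodMk hv)
    have h2 : ((u', v') : ℝ × ℝ) = u' • (1, 0) + v' • (0, 1) := by simp
    rw [h2, map_add, map_smul, map_smul] at h1
    simpa [hax, hat, Function.comp_def] using h1
  have hsc : Continuous s := hs.continuous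
  have hs1 : ContDiff ℝ 1 (deriv s) := (contDiff_succ_iff_deriv (n := 1)).1 hs |>.2.2
  have hs'c : Continuous (deriv s) := hs1.continuous
  have hs''c : Continuous (deriv (deriv s)) := hs1.continuous_deriv le_rfl
  have hds : ∀ t, HasDerivAt s (deriv s t) t := fun t =>
    (hs.differentiable two_ne_zero t).hasDerivAt
  have hdds : ∀ t, HasDerivAt (deriv s) (deriv (deriv s) t) t := fun t =>
    (hs1.differentiable one_ne_zero t).hasDerivAt
  have hne : ∀ x, ∀ t ∈ Set.Icc 0 T, a x t ≠ 0 := fun x t ht => (hapos x t ht).ne'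
  have hasc : Continuous fun t => a (s t) t := hac.comp (hsc.prodMk continuous_id)
  have haxsc : Continuous fun t => ax (s t) t := haxc.comp (hsc.prodMk continuous_id)
  have hatsc : Continuous fun t => at' (s t) t := hatc.comp (hsc.prodMk continuous_id)
  have hdas : ∀ t, HasDerivAt (fun t => a (s t) t)
      (deriv s t * ax (s t) t + at' (s t) t) t := fun t => by
    simpa using hchain (hds t) (hasDerivAt_id t)
  -- The first variation vanishes in every admissible direction.
  have hvar : ∀ η : ℝ → ℝ, ContDiff ℝ 2 η → η 0 = 0 → ∫ t in (0 : ℝ)..T, η t = 0 →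
      ∫ t in (0 : ℝ)..T, (deriv s t / a (s t) t ^ 2 * deriv η t
        - deriv s t ^ 2 * ax (s t) t / a (s t) t ^ 3 * η t) = 0 := by
    intro η hη hη0 hηi
    have hηc : Continuous η := hη.continuous
    have hη'c : Continuous (deriv η) := hη.continuous_deriv one_le_two
    have hpt : ∀ p ∈ (Set.univ : Set ℝ) ×ˢ Set.Icc 0 T, a (s p.2 + p.1 * η p.2) p.2 ≠ 0 :=
      fun p hp => hne _ _ hp.2
    have hGc : ContinuousOn (fun p : ℝ × ℝ =>
        (1 / 2) * ((deriv s p.2 + p.1 * deriv η p.2) / a (s p.2 + p.1 * η p.2) p.2) ^ 2)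
        (Set.univ ×ˢ Set.Icc 0 T) := by
      have : Continuous fun p : ℝ × ℝ => a (s p.2 + p.1 * η p.2) p.2 :=
        hac.comp (f := fun p : ℝ × ℝ => (s p.2 + p.1 * η p.2, p.2)) (by fun_prop)
      exact continuousOn_const.mul (((by fun_prop : Continuous fun p : ℝ × ℝ =>
        deriv s p.2 + p.1 * deriv η p.2).continuousOn.div this.continuousOn hpt).pow 2)
    have hG'c : ContinuousOn (fun p : ℝ × ℝ =>
        (deriv s p.2 + p.1 * deriv η p.2) / a (s p.2 + p.1 * η p.2) p.2 ^ 2 * deriv η p.2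
        - (deriv s p.2 + p.1 * deriv η p.2) ^ 2 * ax (s p.2 + p.1 * η p.2) p.2
          / a (s p.2 + p.1 * η p.2) p.2 ^ 3 * η p.2)
        (Set.univ ×ˢ Set.Icc 0 T) := by
      have h1 : Continuous fun p : ℝ × ℝ => a (s p.2 + p.1 * η p.2) p.2 :=
        hac.comp (f := fun p : ℝ × ℝ => (s p.2 + p.1 * η p.2, p.2)) (by fun_prop)
      have h2 : Continuous fun p : ℝ × ℝ => ax (s p.2 + p.1 * η p.2) p.2 :=
        haxc.comp (f := fun p : ℝ × ℝ => (s p.2 + p.1 * η p.2, p.2)) (by fun_prop)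
      refine .sub (.mul (.div (by fun_prop) (by fun_prop) fun p hp => pow_ne_zero _ (hpt p hp))
        (by fun_prop)) (.mul (.div (by fun_prop) (by fun_prop)
          fun p hp => pow_ne_zero _ (hpt p hp)) (by fun_prop))
    have hder := hasDerivAt_integral_of_continuousOn_deriv hT.le
      (G := fun ε t => (1 / 2) * ((deriv s t + ε * deriv η t) / a (s t + ε * η t) t) ^ 2)
      (G' := fun ε t => (deriv s t + ε * deriv η t) / a (s t + ε * η t) t ^ 2 * deriv η t
        - (deriv s t + ε * deriv η t) ^ 2 * ax (s t + ε * η t) t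
          / a (s t + ε * η t) t ^ 3 * η t)
      (fun ε => hGc.comp (f := fun t => (ε, t)) (by fun_prop) fun t ht => ⟨Set.mem_univ _, ht⟩)
      hG'c (fun ε t ht => by
        have hlin : ∀ x y : ℝ, HasDerivAt (fun ε : ℝ => x + ε * y) y ε := fun x y => by
          simpa using ((hasDerivAt_id ε).mul_const y).const_add x
        have ha0 := hne (s t + ε * η t) t ht
        have := ((((hlin (deriv s t) (deriv η t)).div
          (hchain (hlin (s t) (η t)) (hasDerivAt_const ε t)) ha0).pow 2).const_mul (1 / 2 : ℝ))
        refine this.congr_deriv ?_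
        simp
        field_simp) 0
    have hmin0 : IsLocalMin (fun ε : ℝ => ∫ t in (0 : ℝ)..T,
        (1 / 2) * ((deriv s t + ε * deriv η t) / a (s t + ε * η t) t) ^ 2) 0 := by
      refine .of_forall fun ε => ?_
      have hy : ContDiff ℝ 2 fun t => s t + ε * η t := by fun_prop
      have := hmin _ hy (by simp [hη0, hs0]) (by
        rw [integral_add (hsc.intervalIntegrable _ _)
          ((continuous_const.fun_mul hηc).intervalIntegrable _ _), integral_const_mul, hηi,
          mul_zero, add_zero, hsK])
      have hdy : (deriv fun t => s t + ε * η t) = fun t => deriv s t + ε * deriv η t := by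
        ext t
        exact ((hds t).add ((hη.differentiable two_ne_zero t).hasDerivAt.const_mul ε)).deriv
      simpa [hdy, integral_const_mul] using this
    simpa using hmin0.hasDerivAt_eq_zero hder
  obtain ⟨g, hgdef⟩ : ∃ g : ℝ → ℝ, g = fun t => deriv (deriv s) t / a (s t) t ^ 2
    - 2 * deriv s t * (deriv s t * ax (s t) t + at' (s t) t) / a (s t) t ^ 3
    + deriv s t ^ 2 * ax (s t) t / a (s t) t ^ 3 := ⟨_, rfl⟩
  have hp2 : ∀ t ∈ Set.Icc 0 T, a (s t) t ^ 2 ≠ 0 := fun t ht => pow_ne_zero _ (hne _ t ht)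
  have hp3 : ∀ t ∈ Set.Icc 0 T, a (s t) t ^ 3 ≠ 0 := fun t ht => pow_ne_zero _ (hne _ t ht)
  have hP'c : ContinuousOn (fun t => deriv (deriv s) t / a (s t) t ^ 2
      - 2 * deriv s t * (deriv s t * ax (s t) t + at' (s t) t) / a (s t) t ^ 3)
      (Set.Icc 0 T) :=
    .sub (.div (by fun_prop) (by fun_prop) hp2) (.div (by fun_prop) (by fun_prop) hp3)
  have hQc : ContinuousOn (fun t => deriv s t ^ 2 * ax (s t) t / a (s t) t ^ 3)
      (Set.Icc 0 T) := .div (by fun_prop) (by fun_prop) hp3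
  have hPd : ∀ t ∈ Set.Icc 0 T, HasDerivAt (fun t => deriv s t / a (s t) t ^ 2)
      (deriv (deriv s) t / a (s t) t ^ 2
        - 2 * deriv s t * (deriv s t * ax (s t) t + at' (s t) t) / a (s t) t ^ 3) t := by
    intro t ht
    have h0 := hne (s t) t ht
    refine ((hdds t).div ((hdas t).pow 2) (hp2 t ht)).congr_deriv ?_
    simp
    field_simp
  obtain ⟨hpT, c, hc⟩ := eq_zero_and_exists_const_of_boundary_sub_integral_eq_zero
    (p := deriv s T / a (s T) T ^ 2) (g := g) hT (by rw [hgdef]; exact hP'c.add hQc) (by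
      intro η hη hη0 hηi
      have hηc : Continuous η := hη.continuous
      have hη'c : Continuous (deriv η) := hη.continuous_deriv one_le_two
      have hv := hvar η hη hη0 hηi
      have hPc : ContinuousOn (fun t => deriv s t / a (s t) t ^ 2) (Set.Icc 0 T) :=
        .div (by fun_prop) (by fun_prop) hp2
      rw [integral_sub ((hPc.fun_mul hη'c.continuousOn).intervalIntegrable_of_Icc hT.le)
        ((hQc.fun_mul hηc.continuousOn).intervalIntegrable_of_Icc hT.le),
        integral_mul_deriv_eq_deriv_mul (by rw [Set.uIcc_of_le hT.le]; exact hPd)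
          (fun t _ => (hη.differentiable two_ne_zero t).hasDerivAt)
          (hP'c.intervalIntegrable_of_Icc hT.le) (hη'c.intervalIntegrable _ _),
        hη0, mul_zero, sub_zero, sub_sub,
        ← integral_add ((hP'c.fun_mul hηc.continuousOn).intervalIntegrable_of_Icc hT.le)
          ((hQc.fun_mul hηc.continuousOn).intervalIntegrable_of_Icc hT.le)] at hv
      rw [← hv, hgdef]
      congr 2
      ext t
      ring)
  have hTm : T ∈ Set.Icc 0 T := ⟨hT.le, le_rfl⟩
  refine ⟨by simpa [hne _ T hTm] using hpT, -c * T, fun t ht => ?_⟩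
  have h0 := hne (s t) t ht
  have hd1 := ((hdds t).div (hdas t) h0).deriv
  have hd2 : deriv (fun τ => a (s t) τ) t = at' (s t) t := by
    simpa using (hchain (hasDerivAt_const t (s t)) (hasDerivAt_id t)).deriv
  have hct := hc t ht
  change deriv (fun u => deriv s u / a (s u) u) t = _ at hd1
  rw [hd1, hd2, ← hct, hgdef]
  field_simp
  ring
end

section
/- Let s₀ < K and σ > 0, and for τ > 0 define C_b(τ) = (σ√τ/√(6π)) · exp(−3(s₀−K)²/(2σ²τ)) + (s₀−K) · Φ(√3(s₀−K)/(σ√τ)). Then there exist constants M > 0 and τ₀ > 0 such that for all τ ∈ (0, τ₀): | C_b(τ) · exp(3(s₀−K)²/(2σ²τ)) − σ³τ^{3/2}/(3√(6π)(K−s₀)²) | ≤ M·τ^{5/2}. Equivalently, C_b(τ) = exp(−3(s₀−K)²/(2σ²τ)) · [ σ³τ^{3/2}/(3√(6π)(K−s₀)²) + O(τ^{5/2}) ] as τ → 0⁺. -/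
open Real

/-- The standard normal cumulative distribution function. -/
noncomputable def stdNormalCDF (x : ℝ) : ℝ :=
  (Real.sqrt (2 * Real.pi))⁻¹ * ∫ u in Set.Iic x, Real.exp (-u ^ 2 / 2)

/-- The Bachelier price of a continuously monitored Asian call with spot `s₀`,
strike `K`, volatility `σ` and time to expiry `τ`. -/
noncomputable def bachelierAsianCall (s₀ K σ τ : ℝ) : ℝ :=
  σ * Real.sqrt τ / Real.sqrt (6 * Real.pi) * Real.exp (-3 * (s₀ - K) ^ 2 / (2 * σ ^ 2 * τ))
    + (s₀ - K) * stdNormalCDF (Real.sqrt 3 * (s₀ - K) / (σ * Real.sqrt τ))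

/-- The Gaussian weight against a power of `u⁻¹` is integrable on a half-line below zero. -/
theorem integrableOn_exp_mul_inv_pow {y : ℝ} (hy : y < 0) (n : ℕ) :
    MeasureTheory.IntegrableOn (fun u : ℝ => Real.exp (-u ^ 2 / 2) * u⁻¹ ^ n) (Set.Iic y) := by
  have hg : MeasureTheory.Integrable (fun u : ℝ => Real.exp (-u ^ 2 / 2)) := by
    convert integrable_exp_neg_mul_sq (b := 1 / 2) (by norm_num) using 3
    ring
  refine hg.integrableOn.mul_bdd (c := |y|⁻¹ ^ n) ?_ ?_
  · exact (measurable_id.inv.pow_const n).aestronglyMeasurable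
  · refine (MeasureTheory.ae_restrict_mem measurableSet_Iic).mono fun u hu => ?_
    have hu' : u ≤ y := hu
    rw [norm_pow, norm_inv, Real.norm_eq_abs]
    have hy0 : 0 < |y| := abs_pos.mpr hy.ne
    have : |y| ≤ |u| := by
      rw [abs_of_neg hy, abs_of_neg (hu'.trans_lt hy)]
      linarith
    gcongr

/-- Integration by parts for the Gaussian tail integrals of inverse powers. -/
theorem integral_exp_mul_inv_pow_add {y : ℝ} (hy : y < 0) (n : ℕ) :
    (∫ u in Set.Iic y, Real.exp (-u ^ 2 / 2) * u⁻¹ ^ n)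
        + (n + 1) * ∫ u in Set.Iic y, Real.exp (-u ^ 2 / 2) * u⁻¹ ^ (n + 2)
      = -(Real.exp (-y ^ 2 / 2) * y⁻¹ ^ (n + 1)) := by
  have hderiv : ∀ u ∈ Set.Iic y, HasDerivAt
      (fun u : ℝ => -(Real.exp (-u ^ 2 / 2) * u⁻¹ ^ (n + 1)))
      (Real.exp (-u ^ 2 / 2) * u⁻¹ ^ n
        + (n + 1) * (Real.exp (-u ^ 2 / 2) * u⁻¹ ^ (n + 2))) u := by
    intro u hu
    have hu0 : u ≠ 0 := (lt_of_le_of_lt hu hy).ne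
    have he : HasDerivAt (fun u : ℝ => Real.exp (-u ^ 2 / 2))
        (Real.exp (-u ^ 2 / 2) * (-u)) u := by
      have h := (((hasDerivAt_pow 2 u).fun_neg).div_const 2).exp
      refine h.congr_deriv ?_
      norm_num
      ring
    refine (he.fun_mul ((hasDerivAt_inv hu0).fun_pow (n + 1))).fun_neg.congr_deriv ?_
    simp only [Nat.add_sub_cancel, Nat.cast_add, Nat.cast_one]
    have h : u * u⁻¹ = 1 := mul_inv_cancel₀ hu0
    rw [← inv_pow]
    linear_combination (Real.exp (-u ^ 2 / 2) * u⁻¹ ^ n) * h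
  have htend : Filter.Tendsto (fun u : ℝ => -(Real.exp (-u ^ 2 / 2) * u⁻¹ ^ (n + 1)))
      Filter.atBot (nhds 0) := by
    have hinv : Filter.Tendsto (fun u : ℝ => u⁻¹ ^ (n + 1)) Filter.atBot (nhds 0) := by
      simpa using (tendsto_inv_atBot_zero (𝕜 := ℝ)).pow (n + 1)
    have hprod := bdd_le_mul_tendsto_zero' (f := fun u : ℝ => Real.exp (-u ^ 2 / 2)) 1
      (Filter.Eventually.of_forall fun u => by
        rw [abs_of_pos (Real.exp_pos _)]
        exact Real.exp_le_one_iff.mpr (by nlinarith [sq_nonneg u])) hinv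
    simpa using hprod.neg
  have hn := integrableOn_exp_mul_inv_pow hy n
  have hn2 := (integrableOn_exp_mul_inv_pow hy (n + 2)).const_mul ((n : ℝ) + 1)
  have := MeasureTheory.integral_Iic_of_hasDerivAt_of_tendsto' hderiv (hn.add hn2) htend
  rwa [MeasureTheory.integral_add hn hn2, MeasureTheory.integral_const_mul, sub_zero] at this

/-- Second-order Mills ratio expansion of the lower Gaussian tail. -/
theorem abs_integral_Iic_exp_sub_le {x : ℝ} (hx : 0 < x) :
    |(∫ u in Set.Iic (-x), Real.exp (-u ^ 2 / 2)) * Real.exp (x ^ 2 / 2)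
        - (x⁻¹ - x⁻¹ ^ 3)| ≤ 3 * x⁻¹ ^ 5 := by
  have hy : -x < 0 := by linarith
  have h0 := integral_exp_mul_inv_pow_add hy 0
  have h2 := integral_exp_mul_inv_pow_add hy 2
  have h4 := integral_exp_mul_inv_pow_add hy 4
  have hpos (k : ℕ) (hk : Even k) :
      0 ≤ ∫ u in Set.Iic (-x), Real.exp (-u ^ 2 / 2) * u⁻¹ ^ k :=
    MeasureTheory.integral_nonneg fun u => mul_nonneg (Real.exp_pos _).le (hk.pow_nonneg _)
  have p4 := hpos 4 (by decide)
  have p6 := hpos 6 (by decide)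
  have hE : Real.exp (-(-x) ^ 2 / 2) * Real.exp (x ^ 2 / 2) = 1 := by
    rw [← Real.exp_add, Real.exp_eq_one_iff]
    ring
  have hpow1 : (-x)⁻¹ ^ 1 = -x⁻¹ := by rw [inv_neg, pow_one]
  have hpow3 : (-x)⁻¹ ^ 3 = -x⁻¹ ^ 3 := by rw [inv_neg]; ring
  have hpow5 : (-x)⁻¹ ^ 5 = -x⁻¹ ^ 5 := by rw [inv_neg]; ring
  norm_num only [zero_add, pow_zero, mul_one, Nat.cast_zero, Nat.cast_ofNat, one_mul,
    Nat.reduceAdd, hpow1, hpow3, hpow5] at h0 h2 h4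
  generalize (∫ u in Set.Iic (-x), Real.exp (-u ^ 2 / 2)) = J0 at *
  generalize (∫ u in Set.Iic (-x), Real.exp (-u ^ 2 / 2) * u⁻¹ ^ 2) = J2 at *
  generalize (∫ u in Set.Iic (-x), Real.exp (-u ^ 2 / 2) * u⁻¹ ^ 4) = J4 at *
  generalize (∫ u in Set.Iic (-x), Real.exp (-u ^ 2 / 2) * u⁻¹ ^ 6) = J6 at *
  generalize Real.exp (-(-x) ^ 2 / 2) = e at *
  have hE' := Real.exp_pos (x ^ 2 / 2)
  generalize Real.exp (x ^ 2 / 2) = E at *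
  have hmain : J0 * E - (x⁻¹ - x⁻¹ ^ 3) = 3 * (J4 * E) := by
    linear_combination E * h0 - E * h2 + (x⁻¹ - x⁻¹ ^ 3) * hE
  have hJ4 : J4 * E = x⁻¹ ^ 5 - 5 * (J6 * E) := by
    linear_combination E * h4 + x⁻¹ ^ 5 * hE
  rw [hmain, abs_of_nonneg (by positivity)]
  have := mul_nonneg p6 hE'.le
  linarith

/-- **Small-time expansion of the out-of-the-money Bachelier Asian call price**:
`C_b(τ) = e^{-3(s₀-K)²/(2σ²τ)} [σ³τ^{3/2}/(3√(6π)(K-s₀)²) + O(τ^{5/2})]` as `τ → 0⁺`. -/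
theorem bachelierAsianCall_small_time_expansion
    (s₀ K σ : ℝ) (hK : s₀ < K) (hσ : 0 < σ) :
    ∃ M > (0 : ℝ), ∃ τ₀ > (0 : ℝ), ∀ τ : ℝ, 0 < τ → τ < τ₀ →
      |bachelierAsianCall s₀ K σ τ * Real.exp (3 * (s₀ - K) ^ 2 / (2 * σ ^ 2 * τ))
          - σ ^ 3 * τ ^ ((3 : ℝ) / 2) / (3 * Real.sqrt (6 * Real.pi) * (K - s₀) ^ 2)|
        ≤ M * τ ^ ((5 : ℝ) / 2) := by
  have ha : 0 < K - s₀ := by linarith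
  have h3 : 0 < Real.sqrt 3 := by positivity
  have h2π : 0 < Real.sqrt (2 * Real.pi) := by positivity
  have h3sq : Real.sqrt 3 ^ 2 = 3 := Real.sq_sqrt (by norm_num)
  have h6π : Real.sqrt (6 * Real.pi) = Real.sqrt 3 * Real.sqrt (2 * Real.pi) := by
    rw [← Real.sqrt_mul (by norm_num)]
    ring_nf
  refine ⟨(K - s₀) * (Real.sqrt (2 * Real.pi))⁻¹ * (3 * (σ / (Real.sqrt 3 * (K - s₀))) ^ 5),
    by positivity, 1, one_pos, fun τ hτ _ => ?_⟩
  have ht : 0 < Real.sqrt τ := Real.sqrt_pos.mpr hτ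
  have htsq : Real.sqrt τ ^ 2 = τ := Real.sq_sqrt hτ.le
  have hrpow (k : ℕ) : τ ^ ((k : ℝ) / 2) = Real.sqrt τ ^ k := by
    rw [Real.sqrt_eq_rpow, ← Real.rpow_natCast, ← Real.rpow_mul hτ.le]
    ring_nf
  have hτ3 : τ ^ ((3 : ℝ) / 2) = Real.sqrt τ ^ 3 := by exact_mod_cast hrpow 3
  have hτ5 : τ ^ ((5 : ℝ) / 2) = Real.sqrt τ ^ 5 := by exact_mod_cast hrpow 5
  obtain ⟨x, hx⟩ : ∃ x, x = Real.sqrt 3 * (K - s₀) / (σ * Real.sqrt τ) := ⟨_, rfl⟩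
  have hx0 : 0 < x := by rw [hx]; positivity
  have hxinv : x⁻¹ = σ / (Real.sqrt 3 * (K - s₀)) * Real.sqrt τ := by
    rw [hx, inv_div]
    ring
  have hxsq : 3 * (s₀ - K) ^ 2 / (2 * σ ^ 2 * τ) = x ^ 2 / 2 := by
    rw [hx, div_pow, mul_pow, mul_pow, h3sq, htsq]
    field_simp
    ring
  have hneg : Real.sqrt 3 * (s₀ - K) / (σ * Real.sqrt τ) = -x := by
    rw [hx]
    ring
  have hexp : -3 * (s₀ - K) ^ 2 / (2 * σ ^ 2 * τ) = -(x ^ 2 / 2) := by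
    rw [← hxsq]
    ring
  have hfirst : σ * Real.sqrt τ / Real.sqrt (6 * Real.pi)
      = (K - s₀) * (Real.sqrt (2 * Real.pi))⁻¹ * x⁻¹ := by
    rw [hxinv, h6π]
    field_simp
  have hsecond : σ ^ 3 * Real.sqrt τ ^ 3 / (3 * Real.sqrt (6 * Real.pi) * (K - s₀) ^ 2)
      = (K - s₀) * (Real.sqrt (2 * Real.pi))⁻¹ * x⁻¹ ^ 3 := by
    rw [hxinv, h6π]
    field_simp
    rw [h3sq]
  have hE : Real.exp (-(x ^ 2 / 2)) * Real.exp (x ^ 2 / 2) = 1 := by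
    rw [← Real.exp_add, neg_add_cancel, Real.exp_zero]
  have hmills := abs_integral_Iic_exp_sub_le hx0
  rw [bachelierAsianCall, stdNormalCDF, hτ3, hτ5, hneg, hexp, hxsq, hfirst, hsecond]
  set c := (K - s₀) * (Real.sqrt (2 * Real.pi))⁻¹ with hc
  have hc0 : 0 ≤ c := by positivity
  calc
    _ = |-(c * ((∫ u in Set.Iic (-x), Real.exp (-u ^ 2 / 2)) * Real.exp (x ^ 2 / 2)
          - (x⁻¹ - x⁻¹ ^ 3)))| := by
      congr 1
      rw [hc]
      linear_combination ((K - s₀) * (Real.sqrt (2 * Real.pi))⁻¹ * x⁻¹) * hE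
    _ ≤ c * (3 * x⁻¹ ^ 5) := by
      rw [abs_neg, abs_mul, abs_of_nonneg hc0]
      gcongr
    _ = _ := by
      rw [hxinv]
      ring
end

section
/- Let s₀ < K and σ > 0, and for τ > 0 define C_b(τ) = (σ√τ/√(6π)) · exp(−3(s₀−K)²/(2σ²τ)) + (s₀−K) · Φ(√3(s₀−K)/(σ√τ)). Then lim_{τ→0⁺} τ · log C_b(τ) = −3(K−s₀)²/(2σ²). -/
open Real Filter

theorem hasDerivAt_exp_neg_sq_div_two (u : ℝ) :
    HasDerivAt (fun u : ℝ => Real.exp (-u ^ 2 / 2)) (-u * Real.exp (-u ^ 2 / 2)) u := by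
  have h : HasDerivAt (fun u : ℝ => -u ^ 2 / 2) (-u) u := by
    refine (((hasDerivAt_id u).pow 2).neg.div_const 2).congr_deriv ?_
    simp only [id, Nat.cast_ofNat]
    ring
  exact h.exp.congr_deriv (by ring)

theorem integrable_exp_neg_sq_div_two :
    MeasureTheory.Integrable (fun u : ℝ => Real.exp (-u ^ 2 / 2)) := by
  refine (integrable_exp_neg_mul_sq (b := 1 / 2) (by norm_num)).congr (MeasureTheory.ae_of_all _ fun u => ?_)
  dsimp only
  congr 1
  ring

theorem integrable_neg_mul_exp_neg_sq_div_two :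
    MeasureTheory.Integrable (fun u : ℝ => -u * Real.exp (-u ^ 2 / 2)) := by
  refine (integrable_mul_exp_neg_mul_sq (b := 1 / 2) (by norm_num)).neg.congr
    (MeasureTheory.ae_of_all _ fun u => ?_)
  simp only [Pi.neg_apply, neg_mul, neg_inj]
  congr 2
  ring

theorem tendsto_exp_neg_sq_div_two_atBot :
    Tendsto (fun u : ℝ => Real.exp (-u ^ 2 / 2)) atBot (nhds 0) := by
  have h : Tendsto (fun u : ℝ => |u| ^ 2 / 2) atBot atTop :=
    ((tendsto_pow_atTop two_ne_zero).comp tendsto_abs_atBot_atTop).atTop_div_const two_pos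
  refine (Real.tendsto_exp_neg_atTop_nhds_zero.comp h).congr fun u => ?_
  simp [neg_div]

theorem integral_Iic_sub_mul_exp_neg_sq_div_two (x : ℝ) :
    ∫ u in Set.Iic x, (x - u) * Real.exp (-u ^ 2 / 2) =
      Real.exp (-x ^ 2 / 2) + x * ∫ u in Set.Iic x, Real.exp (-u ^ 2 / 2) := by
  have h := MeasureTheory.integral_Iic_of_hasDerivAt_of_tendsto' (a := x)
    (fun u _ => hasDerivAt_exp_neg_sq_div_two u)
    integrable_neg_mul_exp_neg_sq_div_two.integrableOn tendsto_exp_neg_sq_div_two_atBot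
  rw [sub_zero] at h
  rw [← h, ← MeasureTheory.integral_const_mul, ← MeasureTheory.integral_add
    integrable_neg_mul_exp_neg_sq_div_two.integrableOn
    (integrable_exp_neg_sq_div_two.const_mul x).integrableOn]
  congr 1 with u
  ring

theorem exp_le_integral_Iic_sub_mul_exp_neg_sq_div_two {x : ℝ} (hx : x ≤ 0) :
    Real.exp (-(x - 2) ^ 2 / 2) ≤ ∫ u in Set.Iic x, (x - u) * Real.exp (-u ^ 2 / 2) := by
  have hint : MeasureTheory.Integrable (fun u : ℝ => (x - u) * Real.exp (-u ^ 2 / 2)) := by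
    refine ((integrable_exp_neg_sq_div_two.const_mul x).add
      integrable_neg_mul_exp_neg_sq_div_two).congr (MeasureTheory.ae_of_all _ fun u => ?_)
    simp only [Pi.add_apply]
    ring
  have hsub : Set.Icc (x - 2) (x - 1) ⊆ Set.Iic x := fun u hu => by
    have := hu.2
    simp only [Set.mem_Iic]
    linarith
  calc Real.exp (-(x - 2) ^ 2 / 2)
      = ∫ _ in Set.Icc (x - 2) (x - 1), Real.exp (-(x - 2) ^ 2 / 2) := by
        rw [MeasureTheory.setIntegral_const, Real.volume_real_Icc_of_le (by linarith)]
        simp only [smul_eq_mul]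
        ring
    _ ≤ ∫ u in Set.Icc (x - 2) (x - 1), (x - u) * Real.exp (-u ^ 2 / 2) := by
        refine MeasureTheory.setIntegral_mono_on (by simp) hint.integrableOn
          measurableSet_Icc fun u hu => ?_
        have h1 : 1 ≤ x - u := by linarith [hu.2]
        have h2 : Real.exp (-(x - 2) ^ 2 / 2) ≤ Real.exp (-u ^ 2 / 2) := by
          apply Real.exp_le_exp.mpr
          nlinarith [hu.1, hu.2]
        nlinarith [Real.exp_pos (-u ^ 2 / 2)]
    _ ≤ ∫ u in Set.Iic x, (x - u) * Real.exp (-u ^ 2 / 2) := by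
        refine MeasureTheory.setIntegral_mono_set hint.integrableOn ?_ hsub.eventuallyLE
        refine (MeasureTheory.ae_restrict_iff' measurableSet_Iic).mpr (MeasureTheory.ae_of_all _ fun u hu => ?_)
        exact mul_nonneg (sub_nonneg.mpr hu) (Real.exp_pos _).le

theorem integral_Iic_sub_mul_exp_neg_sq_div_two_le {x : ℝ} (hx : x ≤ 0) :
    ∫ u in Set.Iic x, (x - u) * Real.exp (-u ^ 2 / 2) ≤ Real.exp (-x ^ 2 / 2) := by
  rw [integral_Iic_sub_mul_exp_neg_sq_div_two]
  have : 0 ≤ ∫ u in Set.Iic x, Real.exp (-u ^ 2 / 2) :=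
    MeasureTheory.integral_nonneg fun u => (Real.exp_pos _).le
  nlinarith

theorem bachelierAsianCall_eq_mul_integral (s₀ K : ℝ) {σ τ : ℝ} (hσ : 0 < σ) (hτ : 0 < τ) :
    bachelierAsianCall s₀ K σ τ = σ / Real.sqrt (6 * Real.pi) * Real.sqrt τ *
      ∫ u in Set.Iic (Real.sqrt 3 * (s₀ - K) / (σ * Real.sqrt τ)),
        (Real.sqrt 3 * (s₀ - K) / (σ * Real.sqrt τ) - u) * Real.exp (-u ^ 2 / 2) := by
  have hs : 0 < Real.sqrt τ := Real.sqrt_pos.mpr hτ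
  have hπ : 0 < Real.sqrt (2 * Real.pi) := Real.sqrt_pos.mpr (by positivity)
  have h3 : 0 < Real.sqrt 3 := by positivity
  have h6 : Real.sqrt (6 * Real.pi) = Real.sqrt 3 * Real.sqrt (2 * Real.pi) := by
    rw [← Real.sqrt_mul (by norm_num)]
    congr 1
    ring
  have hexp : -(Real.sqrt 3 * (s₀ - K) / (σ * Real.sqrt τ)) ^ 2 / 2 =
      -3 * (s₀ - K) ^ 2 / (2 * σ ^ 2 * τ) := by
    rw [div_pow, mul_pow, mul_pow, Real.sq_sqrt hτ.le, Real.sq_sqrt (by norm_num)]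
    field_simp
  rw [integral_Iic_sub_mul_exp_neg_sq_div_two, bachelierAsianCall, stdNormalCDF, hexp, h6]
  field_simp

theorem tendsto_mul_log_const_mul_sqrt {c : ℝ} (hc : c ≠ 0) :
    Tendsto (fun τ : ℝ => τ * Real.log (c * Real.sqrt τ)) (nhdsWithin 0 (Set.Ioi 0))
      (nhds 0) := by
  have hid : Tendsto (fun τ : ℝ => τ) (nhdsWithin 0 (Set.Ioi 0)) (nhds 0) :=
    tendsto_id.mono_left nhdsWithin_le_nhds
  have hlog : Tendsto (fun τ : ℝ => τ * Real.log τ) (nhdsWithin 0 (Set.Ioi 0)) (nhds 0) := by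
    simpa using (Real.continuous_mul_log.tendsto 0).mono_left nhdsWithin_le_nhds
  have h := (hid.mul_const (Real.log c)).add (hlog.div_const 2)
  simp only [zero_mul, zero_div, add_zero] at h
  refine h.congr' ?_
  filter_upwards [self_mem_nhdsWithin] with τ (hτ : 0 < τ)
  rw [Real.log_mul hc (Real.sqrt_pos.mpr hτ).ne', Real.log_sqrt hτ.le]
  ring

/-- **Exponential decay rate of the out-of-the-money Bachelier Asian call**:
`lim_{τ→0⁺} τ log C_b(τ) = -3(K-s₀)²/(2σ²)`. -/
theorem bachelierAsianCall_log_limit (s₀ K σ : ℝ) (hK : s₀ < K) (hσ : 0 < σ) :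
    Tendsto (fun τ : ℝ => τ * Real.log (bachelierAsianCall s₀ K σ τ))
      (nhdsWithin 0 (Set.Ioi 0)) (nhds (-3 * (K - s₀) ^ 2 / (2 * σ ^ 2))) := by
  set c : ℝ := σ / Real.sqrt (6 * Real.pi) with hc_def
  have hc : 0 < c := by positivity
  set b : ℝ := Real.sqrt 3 * (s₀ - K) / σ with hb_def
  have hb : b ≤ 0 :=
    div_nonpos_of_nonpos_of_nonneg
      (mul_nonpos_of_nonneg_of_nonpos (Real.sqrt_nonneg 3) (by linarith)) hσ.le
  have hlim : -3 * (K - s₀) ^ 2 / (2 * σ ^ 2) = 0 + -b ^ 2 / 2 := by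
    rw [hb_def, div_pow, mul_pow, Real.sq_sqrt (by norm_num)]
    field_simp
    ring
  have hsqrt : Tendsto (fun τ : ℝ => -(b - 2 * Real.sqrt τ) ^ 2 / 2)
      (nhdsWithin 0 (Set.Ioi 0)) (nhds (-b ^ 2 / 2)) := by
    have h : Continuous fun τ : ℝ => -(b - 2 * Real.sqrt τ) ^ 2 / 2 := by fun_prop
    simpa using (h.tendsto 0).mono_left nhdsWithin_le_nhds
  have hlog := tendsto_mul_log_const_mul_sqrt hc.ne'
  rw [hlim]
  refine tendsto_of_tendsto_of_tendsto_of_le_of_le' (hlog.add hsqrt)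
    (hlog.add tendsto_const_nhds) ?_ ?_
  all_goals
    filter_upwards [self_mem_nhdsWithin] with τ (hτ : 0 < τ)
    have hs : 0 < Real.sqrt τ := Real.sqrt_pos.mpr hτ
    have hss : Real.sqrt τ ^ 2 = τ := Real.sq_sqrt hτ.le
    have hx : b / Real.sqrt τ ≤ 0 := div_nonpos_of_nonpos_of_nonneg hb hs.le
    have hlow := exp_le_integral_Iic_sub_mul_exp_neg_sq_div_two hx
    have hpos := (Real.exp_pos _).trans_le hlow
    rw [bachelierAsianCall_eq_mul_integral s₀ K hσ hτ, ← div_div, ← hb_def, ← hc_def,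
      Real.log_mul (by positivity) hpos.ne', mul_add]
    gcongr
  · calc -(b - 2 * Real.sqrt τ) ^ 2 / 2 = τ * (-(b / Real.sqrt τ - 2) ^ 2 / 2) := by
          rw [← hss, Real.sqrt_sq hs.le]
          field_simp
      _ ≤ _ := mul_le_mul_of_nonneg_left ((Real.le_log_iff_exp_le hpos).mpr hlow) hτ.le
  · calc _ ≤ τ * (-(b / Real.sqrt τ) ^ 2 / 2) :=
          mul_le_mul_of_nonneg_left ((Real.log_le_iff_le_exp hpos).mpr
            (integral_Iic_sub_mul_exp_neg_sq_div_two_le hx)) hτ.le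
      _ = -b ^ 2 / 2 := by
          rw [div_pow, hss]
          field_simp
end

section
/- Let s₀ > 0, T > 0, c₁ > 0 and define s : [0,T] → ℝ by s(t) = s₀ · cosh²(c₁T/2) / cosh²(c₁(T−t)/2). Then: (i) s(0) = s₀; (ii) ṡ(T) = 0; (iii) for all t ∈ [0,T], −s̈(t)/s(t)² + ṡ(t)²/s(t)³ = c₁²/(2 s₀ cosh²(c₁T/2)), so s solves the Black–Scholes Euler–Lagrange equation −s̈/s² + ṡ²/s³ = λσ² with λσ² = c₁²/(2 s₀ cosh²(c₁T/2)); and (iv) (1/T)∫₀ᵀ s(t) dt = s₀ · sinh(c₁T)/(c₁T). In particular, for K > 0 the constraint (1/T)∫₀ᵀ s(t) dt = K holds if and only if c₁T/sinh(c₁T) = s₀/K. -/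
open Real intervalIntegral

/-- The derivative in time of the half-argument `c(T-t)/2`. -/
theorem hasDerivAt_half_mul_sub (c T t : ℝ) :
    HasDerivAt (fun t => c * (T - t) / 2) (-c / 2) t := by
  have h := (((hasDerivAt_id t).const_sub T).const_mul c).div_const 2
  exact h.congr_deriv (by ring)

theorem hasDerivAt_const_div_cosh_sq (A c T t : ℝ) :
    HasDerivAt (fun t => A / Real.cosh (c * (T - t) / 2) ^ 2)
      (A * c * Real.sinh (c * (T - t) / 2) / Real.cosh (c * (T - t) / 2) ^ 3) t := by
  have hpos := (Real.cosh_pos (c * (T - t) / 2)).ne'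
  have h := (hasDerivAt_const t A).fun_div ((hasDerivAt_half_mul_sub c T t).cosh.fun_pow 2)
    (pow_ne_zero 2 hpos)
  refine h.congr_deriv ?_
  push_cast
  field_simp
  ring

theorem hasDerivAt_const_mul_sinh_div_cosh_cube (A c T t : ℝ) :
    HasDerivAt (fun t => A * c * Real.sinh (c * (T - t) / 2) / Real.cosh (c * (T - t) / 2) ^ 3)
      (A * c ^ 2 / 2 * (3 * Real.sinh (c * (T - t) / 2) ^ 2 - Real.cosh (c * (T - t) / 2) ^ 2) /
        Real.cosh (c * (T - t) / 2) ^ 4) t := by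
  have hpos := (Real.cosh_pos (c * (T - t) / 2)).ne'
  have hu := hasDerivAt_half_mul_sub c T t
  have h := (hu.sinh.const_mul (A * c)).fun_div (hu.cosh.fun_pow 3) (pow_ne_zero 3 hpos)
  refine h.congr_deriv ?_
  push_cast
  field_simp
  ring

theorem hasDerivAt_const_mul_sinh_div_cosh (A c T t : ℝ) (hc : c ≠ 0) :
    HasDerivAt
      (fun t => -(2 * A / c) * (Real.sinh (c * (T - t) / 2) / Real.cosh (c * (T - t) / 2)))
      (A / Real.cosh (c * (T - t) / 2) ^ 2) t := by
  have hpos := (Real.cosh_pos (c * (T - t) / 2)).ne'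
  have hu := hasDerivAt_half_mul_sub c T t
  have h := (hu.sinh.fun_div hu.cosh hpos).const_mul (-(2 * A / c))
  refine h.congr_deriv ?_
  have hsq := Real.cosh_sq (c * (T - t) / 2)
  field_simp
  linear_combination A * hsq

theorem integral_const_div_cosh_sq (A c T : ℝ) (hc : c ≠ 0) :
    ∫ t in (0 : ℝ)..T, A / Real.cosh (c * (T - t) / 2) ^ 2 =
      2 * A / c * (Real.sinh (c * T / 2) / Real.cosh (c * T / 2)) := by
  have hcont : Continuous fun t : ℝ => A / Real.cosh (c * (T - t) / 2) ^ 2 :=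
    continuous_const.div (by fun_prop) fun t => pow_ne_zero 2 (Real.cosh_pos _).ne'
  rw [integral_eq_sub_of_hasDerivAt
    (fun t _ => hasDerivAt_const_mul_sinh_div_cosh A c T t hc) (hcont.intervalIntegrable 0 T)]
  simp

/-- **The most-likely-path of the out-of-the-money Asian call in the Black–Scholes model**
`a(s,t) = σs`: the path `s(t) = s₀ cosh²(c₁T/2)/cosh²(c₁(T-t)/2)` satisfies `s(0) = s₀`,
`ṡ(T) = 0`, the Euler–Lagrange equation `-s̈/s² + ṡ²/s³ = c₁²/(2 s₀ cosh²(c₁T/2))`, and its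
average is `s₀ sinh(c₁T)/(c₁T)`; in particular the constraint `(1/T)∫₀ᵀ s = K` holds
iff `c₁T/sinh(c₁T) = s₀/K`. -/
theorem blackScholes_most_likely_path_otm (s₀ T c₁ : ℝ) (hs₀ : 0 < s₀) (hT : 0 < T)
    (hc₁ : 0 < c₁) (s : ℝ → ℝ)
    (hs : ∀ t, s t = s₀ * Real.cosh (c₁ * T / 2) ^ 2 / Real.cosh (c₁ * (T - t) / 2) ^ 2) :
    s 0 = s₀ ∧
    deriv s T = 0 ∧
    (∀ t ∈ Set.Icc (0 : ℝ) T,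
      -(deriv (deriv s) t) / (s t) ^ 2 + (deriv s t) ^ 2 / (s t) ^ 3 =
        c₁ ^ 2 / (2 * s₀ * Real.cosh (c₁ * T / 2) ^ 2)) ∧
    (1 / T) * ∫ t in (0 : ℝ)..T, s t = s₀ * Real.sinh (c₁ * T) / (c₁ * T) ∧
    (∀ K : ℝ, 0 < K →
      ((1 / T) * ∫ t in (0 : ℝ)..T, s t = K ↔ c₁ * T / Real.sinh (c₁ * T) = s₀ / K)) := by
  have hC := Real.cosh_pos (c₁ * T / 2)
  set A := s₀ * Real.cosh (c₁ * T / 2) ^ 2 with hA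
  have hs_eq : s = fun t => A / Real.cosh (c₁ * (T - t) / 2) ^ 2 := funext hs
  have hd : deriv s = fun t =>
      A * c₁ * Real.sinh (c₁ * (T - t) / 2) / Real.cosh (c₁ * (T - t) / 2) ^ 3 := by
    rw [hs_eq]
    exact funext fun t => (hasDerivAt_const_div_cosh_sq A c₁ T t).deriv
  have hdd : ∀ t, deriv (deriv s) t =
      A * c₁ ^ 2 / 2 *
        (3 * Real.sinh (c₁ * (T - t) / 2) ^ 2 - Real.cosh (c₁ * (T - t) / 2) ^ 2) /
          Real.cosh (c₁ * (T - t) / 2) ^ 4 := fun t => by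
    rw [hd]
    exact (hasDerivAt_const_mul_sinh_div_cosh_cube A c₁ T t).deriv
  have havg : (1 / T) * ∫ t in (0 : ℝ)..T, s t = s₀ * Real.sinh (c₁ * T) / (c₁ * T) := by
    have hsinh : Real.sinh (c₁ * T) =
        2 * Real.sinh (c₁ * T / 2) * Real.cosh (c₁ * T / 2) := by
      rw [← Real.sinh_two_mul]
      congr 1
      ring
    rw [hs_eq, integral_const_div_cosh_sq A c₁ T hc₁.ne', hsinh, hA]
    field_simp
  refine ⟨?_, ?_, fun t _ => ?_, havg, fun K hK => ?_⟩
  · rw [hs, hA, sub_zero]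
    field_simp
  · simp [hd]
  · have hpos := Real.cosh_pos (c₁ * (T - t) / 2)
    have hsq := Real.cosh_sq (c₁ * (T - t) / 2)
    have hApos : 0 < A := by positivity
    rw [mul_assoc 2 s₀, ← hA, hdd, hd, hs]
    field_simp
    linear_combination hsq
  · have hsinh : 0 < Real.sinh (c₁ * T) := Real.sinh_pos_iff.mpr (by positivity)
    have hcT : 0 < c₁ * T := by positivity
    rw [havg, div_eq_iff hcT.ne', div_eq_div_iff hsinh.ne' hK.ne', mul_comm K, eq_comm]
end

section
/- Let s₀ > 0, σ > 0, T > 0, c₁ > 0 and define s : [0,T] → ℝ by s(t) = s₀ · cosh²(c₁T/2) / cosh²(c₁(T−t)/2). Then (1/2)∫₀ᵀ (ṡ(t)/(σ s(t)))² dt = (c₁/σ²) · ( c₁T/2 − tanh(c₁T/2) ). In particular, if c₁ = f⁻¹(s₀/K)/T where f(x) = x/sinh(x) and 0 < s₀ < K, this value equals (f⁻¹(s₀/K)/(σ²T)) · [ (1/2) f⁻¹(s₀/K) − tanh( (1/2) f⁻¹(s₀/K) ) ]. -/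
open Real intervalIntegral

lemma Real.hasDerivAt_sinh_div_cosh (x : ℝ) :
    HasDerivAt (fun y => Real.sinh y / Real.cosh y) (1 / Real.cosh x ^ 2) x := by
  have hx : Real.cosh x ≠ 0 := (Real.cosh_pos x).ne'
  refine ((Real.hasDerivAt_sinh x).div (Real.hasDerivAt_cosh x) hx).congr_deriv ?_
  rw [← Real.cosh_sq_sub_sinh_sq x]
  ring

lemma hasDerivAt_const_mul_sub_div_two (c T t : ℝ) :
    HasDerivAt (fun u => c * (T - u) / 2) (-(c / 2)) t := by
  refine ((((hasDerivAt_id' t).const_sub T).const_mul c).div_const 2).congr_deriv ?_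
  ring

/-- The path `A / cosh² (c (T - t) / 2)` has logarithmic derivative `c tanh (c (T - t) / 2)`. -/
lemma hasDerivAt_div_cosh_sq (A c T t : ℝ) :
    HasDerivAt (fun u => A / Real.cosh (c * (T - u) / 2) ^ 2)
      (A / Real.cosh (c * (T - t) / 2) ^ 2 *
        (c * (Real.sinh (c * (T - t) / 2) / Real.cosh (c * (T - t) / 2)))) t := by
  have hx : Real.cosh (c * (T - t) / 2) ≠ 0 := (Real.cosh_pos _).ne'
  refine ((hasDerivAt_const t A).div ((hasDerivAt_const_mul_sub_div_two c T t).cosh.pow 2)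
    (pow_ne_zero 2 hx)).congr_deriv ?_
  simp only [Pi.pow_apply]
  field_simp
  ring

lemma integral_sq_mul_sinh_div_cosh (c σ T : ℝ) (hc : c ≠ 0) :
    ∫ t in (0 : ℝ)..T,
        (c * (Real.sinh (c * (T - t) / 2) / Real.cosh (c * (T - t) / 2)) / σ) ^ 2 =
      2 * (c / σ ^ 2 * (c * T / 2 - Real.tanh (c * T / 2))) := by
  have hcosh (t : ℝ) : Real.cosh (c * (T - t) / 2) ≠ 0 := (Real.cosh_pos _).ne'
  have hderiv (t : ℝ) : HasDerivAt
      (fun u => c ^ 2 / σ ^ 2 *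
        (u + 2 / c * (Real.sinh (c * (T - u) / 2) / Real.cosh (c * (T - u) / 2))))
      ((c * (Real.sinh (c * (T - t) / 2) / Real.cosh (c * (T - t) / 2)) / σ) ^ 2) t := by
    have h := (Real.hasDerivAt_sinh_div_cosh (c * (T - t) / 2)).comp t
      (hasDerivAt_const_mul_sub_div_two c T t)
    refine (((hasDerivAt_id' t).add (h.const_mul (2 / c))).const_mul (c ^ 2 / σ ^ 2)).congr_deriv ?_
    have := hcosh t
    rw [div_pow, mul_pow, div_pow, Real.sinh_sq]
    field_simp
    ring
  rw [integral_eq_sub_of_hasDerivAt (fun t _ => hderiv t)]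
  · simp only [sub_self, mul_zero, zero_div, Real.sinh_zero, sub_zero, Real.tanh_eq_sinh_div_cosh]
    field_simp
    ring
  · refine Continuous.intervalIntegrable ?_ _ _
    fun_prop (disch := exact hcosh _)

/-- **Action of the Black–Scholes most-likely-path (out-of-the-money case)**: for the path
`s(t) = s₀ cosh²(c₁T/2)/cosh²(c₁(T-t)/2)` one has
`(1/2)∫₀ᵀ (ṡ/(σs))² dt = (c₁/σ²)(c₁T/2 - tanh(c₁T/2))`.  In particular, when `c₁` is
chosen so that `c₁T/sinh(c₁T) = s₀/K` (i.e. `c₁T = f⁻¹(s₀/K)` with `f(x) = x/sinh x`)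
for `0 < s₀ < K`, this value equals
`(c₁T/(σ²T)) [ (1/2)(c₁T) - tanh((1/2)(c₁T)) ]`. -/
theorem blackScholes_most_likely_path_action (s₀ σ T c₁ : ℝ) (hs₀ : 0 < s₀)
    (hσ : 0 < σ) (hT : 0 < T) (hc₁ : 0 < c₁) (s : ℝ → ℝ)
    (hs : ∀ t, s t = s₀ * Real.cosh (c₁ * T / 2) ^ 2 / Real.cosh (c₁ * (T - t) / 2) ^ 2) :
    ((1 / 2) * ∫ t in (0 : ℝ)..T, (deriv s t / (σ * s t)) ^ 2 =
      c₁ / σ ^ 2 * (c₁ * T / 2 - Real.tanh (c₁ * T / 2))) ∧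
    (∀ K : ℝ, s₀ < K → c₁ * T / Real.sinh (c₁ * T) = s₀ / K →
      (1 / 2) * ∫ t in (0 : ℝ)..T, (deriv s t / (σ * s t)) ^ 2 =
        (c₁ * T) / (σ ^ 2 * T) * ((1 / 2) * (c₁ * T) - Real.tanh ((1 / 2) * (c₁ * T)))) := by
  have hint : (1 / 2) * ∫ t in (0 : ℝ)..T, (deriv s t / (σ * s t)) ^ 2 =
      c₁ / σ ^ 2 * (c₁ * T / 2 - Real.tanh (c₁ * T / 2)) := by
    have hlog (t : ℝ) : deriv s t / (σ * s t) =
        c₁ * (Real.sinh (c₁ * (T - t) / 2) / Real.cosh (c₁ * (T - t) / 2)) / σ := by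
      have hpos : 0 < s t := by
        have := Real.cosh_pos (c₁ * T / 2)
        have := Real.cosh_pos (c₁ * (T - t) / 2)
        rw [hs t]
        positivity
      have hderiv : deriv s t = s t *
          (c₁ * (Real.sinh (c₁ * (T - t) / 2) / Real.cosh (c₁ * (T - t) / 2))) := by
        rw [hs t, funext hs]
        exact (hasDerivAt_div_cosh_sq _ c₁ T t).deriv
      rw [hderiv, mul_comm σ, mul_div_mul_left _ _ hpos.ne']
    simp only [hlog]
    rw [integral_sq_mul_sinh_div_cosh c₁ σ T hc₁.ne']
    ring
  refine ⟨hint, fun K _ _ => ?_⟩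
  rw [hint, mul_div_mul_right _ _ hT.ne', one_div_mul_eq_div]
end

section
/- Let s₀ > 0, T > 0, φ > 0 with √φ·T < π/2, and define s : [0,T] → ℝ by s(t) = s₀ · cos²(√φ(T−t)) / cos²(√φ T). Then: (i) s(t) > 0 on [0,T] and s(0) = s₀; (ii) ṡ(T) = 0; (iii) the function x(t) := √(s(t)) satisfies ẍ(t) + φ·x(t) = 0 for all t ∈ [0,T], equivalently (d/dt)(ṡ/√s) + 2φ√s = 0, the CIR Euler–Lagrange equation; and (iv) (1/T)∫₀ᵀ s(t) dt = (s₀/(2√φ T)) · [ tan(√φ T) + √φ T · sec²(√φ T) ]. -/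
open Real intervalIntegral

theorem hasDerivAt_const_mul_cos_mul_sub (k w T t : ℝ) :
    HasDerivAt (fun u => k * Real.cos (w * (T - u))) (k * w * Real.sin (w * (T - t))) t := by
  have h : HasDerivAt (fun u => w * (T - u)) (-w) t := by
    simpa using ((hasDerivAt_id t).const_sub T).const_mul w
  exact (h.cos.const_mul k).congr_deriv (by ring)

theorem hasDerivAt_const_mul_sin_mul_sub (k w T t : ℝ) :
    HasDerivAt (fun u => k * Real.sin (w * (T - u))) (-(k * w * Real.cos (w * (T - t)))) t := by
  have h : HasDerivAt (fun u => w * (T - u)) (-w) t := by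
    simpa using ((hasDerivAt_id t).const_sub T).const_mul w
  exact (h.sin.const_mul k).congr_deriv (by ring)

theorem hasDerivAt_sq_const_mul_cos_mul_sub (k w T t : ℝ) :
    HasDerivAt (fun u => (k * Real.cos (w * (T - u))) ^ 2)
      (2 * (k * Real.cos (w * (T - t))) * (k * w * Real.sin (w * (T - t)))) t :=
  ((hasDerivAt_const_mul_cos_mul_sub k w T t).pow 2).congr_deriv (by simp)

theorem integral_sq_const_mul_cos_mul_sub (k T : ℝ) {w : ℝ} (hw : w ≠ 0) :
    ∫ t in (0 : ℝ)..T, (k * Real.cos (w * (T - t))) ^ 2 =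
      k ^ 2 * (T / 2 + Real.sin (w * T) * Real.cos (w * T) / (2 * w)) := by
  have hF (t : ℝ) : HasDerivAt
      (fun u => k ^ 2 / 2 * u -
        k ^ 2 / (2 * w) * Real.sin (w * (T - u)) * (1 * Real.cos (w * (T - u))))
      ((k * Real.cos (w * (T - t))) ^ 2) t := by
    refine (((hasDerivAt_id t).const_mul (k ^ 2 / 2)).sub
      ((hasDerivAt_const_mul_sin_mul_sub (k ^ 2 / (2 * w)) w T t).mul
        (hasDerivAt_const_mul_cos_mul_sub 1 w T t))).congr_deriv ?_
    field_simp
    linear_combination -k ^ 2 * Real.sin_sq_add_cos_sq (w * (T - t))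
  rw [integral_eq_sub_of_hasDerivAt (fun t _ => hF t)
    (Continuous.intervalIntegrable (by fun_prop) _ _)]
  simp
  ring

/-- **The most-likely-path of the out-of-the-money Asian call in the CIR model**
`a(s,t) = σ√s`: the path `s(t) = s₀ cos²(√φ(T-t))/cos²(√φT)` with `√φ T < π/2` is
positive, satisfies `s(0) = s₀` and `ṡ(T) = 0`, the function `x = √s` solves
`ẍ + φx = 0` (equivalently `(d/dt)(ṡ/√s) + 2φ√s = 0`, the CIR Euler–Lagrange
equation), and the average equals
`(s₀/(2√φT)) [tan(√φT) + √φT sec²(√φT)]`. -/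
theorem cir_most_likely_path_otm (s₀ T φ : ℝ) (hs₀ : 0 < s₀) (hT : 0 < T) (hφ : 0 < φ)
    (hφT : Real.sqrt φ * T < Real.pi / 2) (s : ℝ → ℝ)
    (hs : ∀ t, s t = s₀ * Real.cos (Real.sqrt φ * (T - t)) ^ 2 / Real.cos (Real.sqrt φ * T) ^ 2) :
    (∀ t ∈ Set.Icc (0 : ℝ) T, 0 < s t) ∧
    s 0 = s₀ ∧
    deriv s T = 0 ∧
    (∀ t ∈ Set.Icc (0 : ℝ) T,
      deriv (deriv fun u => Real.sqrt (s u)) t + φ * Real.sqrt (s t) = 0) ∧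
    (∀ t ∈ Set.Icc (0 : ℝ) T,
      deriv (fun u => deriv s u / Real.sqrt (s u)) t + 2 * φ * Real.sqrt (s t) = 0) ∧
    (1 / T) * ∫ t in (0 : ℝ)..T, s t =
      s₀ / (2 * Real.sqrt φ * T) *
        (Real.tan (Real.sqrt φ * T) +
          Real.sqrt φ * T * (1 / Real.cos (Real.sqrt φ * T)) ^ 2) := by
  set w := Real.sqrt φ
  have hwpos : 0 < w := Real.sqrt_pos.mpr hφ
  have hwsq : w ^ 2 = φ := Real.sq_sqrt hφ.le
  have hcos {t : ℝ} (ht : t ∈ Set.Icc (0 : ℝ) T) : 0 < Real.cos (w * (T - t)) := by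
    refine Real.cos_pos_of_mem_Ioo ⟨?_, ?_⟩
    · have := mul_nonneg hwpos.le (sub_nonneg.mpr ht.2)
      linarith [Real.pi_pos]
    · have := mul_nonneg hwpos.le ht.1
      linarith [mul_sub w T t]
  have hC : 0 < Real.cos (w * T) := by simpa using hcos (Set.left_mem_Icc.mpr hT.le)
  obtain ⟨k, hk⟩ : ∃ k, k = Real.sqrt s₀ / Real.cos (w * T) := ⟨_, rfl⟩
  have hkpos : 0 < k := hk ▸ div_pos (Real.sqrt_pos.mpr hs₀) hC
  have hksq : k ^ 2 = s₀ / Real.cos (w * T) ^ 2 := by rw [hk, div_pow, Real.sq_sqrt hs₀.le]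
  have hs' : s = fun t => (k * Real.cos (w * (T - t))) ^ 2 := by
    funext t
    rw [hs, mul_pow, hksq]
    ring
  have hds (t : ℝ) : deriv s t =
      2 * (k * Real.cos (w * (T - t))) * (k * w * Real.sin (w * (T - t))) := by
    rw [hs']
    exact (hasDerivAt_sq_const_mul_cos_mul_sub k w T t).deriv
  have hsqrt {t : ℝ} (ht : 0 < Real.cos (w * (T - t))) :
      Real.sqrt (s t) = k * Real.cos (w * (T - t)) := by
    rw [hs']
    exact Real.sqrt_sq (mul_pos hkpos ht).le
  have hnear {t : ℝ} (ht : t ∈ Set.Icc (0 : ℝ) T) :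
      ∀ᶠ u in nhds t, 0 < Real.cos (w * (T - u)) :=
    ContinuousAt.eventually_lt continuousAt_const
      (Continuous.continuousAt (by fun_prop)) (hcos ht)
  refine ⟨fun t ht => ?_, ?_, ?_, fun t ht => ?_, fun t ht => ?_, ?_⟩
  · rw [hs']
    exact pow_pos (mul_pos hkpos (hcos ht)) 2
  · rw [hs, sub_zero]
    field_simp
  · simp [hds]
  · have hx : (fun u => Real.sqrt (s u)) =ᶠ[nhds t] fun u => k * Real.cos (w * (T - u)) :=
      (hnear ht).mono fun u hu => hsqrt hu
    have hx' : (deriv fun u => k * Real.cos (w * (T - u))) =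
        fun u => k * w * Real.sin (w * (T - u)) :=
      funext fun u => (hasDerivAt_const_mul_cos_mul_sub k w T u).deriv
    rw [hx.deriv.deriv_eq, hx', (hasDerivAt_const_mul_sin_mul_sub (k * w) w T t).deriv,
      hsqrt (hcos ht), ← hwsq]
    ring
  · have hq : (fun u => deriv s u / Real.sqrt (s u)) =ᶠ[nhds t]
        fun u => 2 * k * w * Real.sin (w * (T - u)) := by
      filter_upwards [hnear ht] with u hu
      rw [hds, hsqrt hu]
      field_simp
    rw [hq.deriv_eq, (hasDerivAt_const_mul_sin_mul_sub (2 * k * w) w T t).deriv,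
      hsqrt (hcos ht), ← hwsq]
    ring
  · rw [hs', integral_sq_const_mul_cos_mul_sub k T hwpos.ne', hksq, Real.tan_eq_sin_div_cos]
    field_simp
    ring
end

section
/- Let s₀ > 0, σ > 0, T > 0, φ > 0 with √φ·T < π/2, and let s(t) = s₀ · cos²(√φ(T−t)) / cos²(√φ T) for t ∈ [0,T]. Then ∫₀ᵀ ( ṡ(t) / (σ√(s(t))) )² dt = (s₀√φ/σ²) · [ 2√φ T − sin(2√φ T) ] · sec²(√φ T). -/
open Real intervalIntegral

/-- **Action of the CIR most-likely-path (out-of-the-money case)**: for the path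
`s(t) = s₀ cos²(√φ(T-t))/cos²(√φT)` with `√φ T < π/2`,
`∫₀ᵀ (ṡ/(σ√s))² dt = (s₀√φ/σ²) [2√φT - sin(2√φT)] sec²(√φT)`. -/
theorem cir_most_likely_path_action_otm (s₀ σ T φ : ℝ) (hs₀ : 0 < s₀) (hσ : 0 < σ)
    (hT : 0 < T) (hφ : 0 < φ) (hφT : Real.sqrt φ * T < Real.pi / 2) (s : ℝ → ℝ)
    (hs : ∀ t, s t = s₀ * Real.cos (Real.sqrt φ * (T - t)) ^ 2 / Real.cos (Real.sqrt φ * T) ^ 2) :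
    ∫ t in (0 : ℝ)..T, (deriv s t / (σ * Real.sqrt (s t))) ^ 2 =
      s₀ * Real.sqrt φ / σ ^ 2 *
        (2 * Real.sqrt φ * T - Real.sin (2 * Real.sqrt φ * T)) *
        (1 / Real.cos (Real.sqrt φ * T)) ^ 2 := by
  set k := Real.sqrt φ with hk
  have hk0 : 0 < k := Real.sqrt_pos.mpr hφ
  have hpos : ∀ t ∈ Set.Icc (0 : ℝ) T, 0 < Real.cos (k * (T - t)) := fun t ht => by
    have h1 : 0 ≤ k * (T - t) := mul_nonneg hk0.le (sub_nonneg.mpr ht.2)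
    have h2 : 0 ≤ k * t := mul_nonneg hk0.le ht.1
    exact Real.cos_pos_of_mem_Ioo ⟨by linarith [Real.pi_pos], by linarith⟩
  have hc : 0 < Real.cos (k * T) := by simpa using hpos 0 ⟨le_rfl, hT.le⟩
  have hlin : ∀ a t : ℝ, HasDerivAt (fun t => a * (T - t)) (-a) t := fun a t => by
    simpa using ((hasDerivAt_id t).const_sub T).const_mul a
  have hds : ∀ t, deriv s t =
      s₀ * (2 * Real.cos (k * (T - t)) * (Real.sin (k * (T - t)) * k)) /
        Real.cos (k * T) ^ 2 := fun t => by
    rw [funext hs]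
    have h := ((((hlin k t).cos.pow 2).const_mul s₀).div_const (Real.cos (k * T) ^ 2)).deriv
    refine Eq.trans h ?_
    norm_num
  have hint : ∀ t ∈ Set.uIcc (0 : ℝ) T, (deriv s t / (σ * Real.sqrt (s t))) ^ 2 =
      s₀ * k / (σ ^ 2 * Real.cos (k * T) ^ 2) *
        (2 * k + Real.cos (2 * k * (T - t)) * (-(2 * k))) := fun t ht => by
    rw [Set.uIcc_of_le hT.le] at ht
    have hct := hpos t ht
    have hst : 0 ≤ s t := by rw [hs]; positivity
    have hcos : Real.cos (2 * k * (T - t)) = 1 - 2 * Real.sin (k * (T - t)) ^ 2 := by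
      rw [mul_assoc, Real.cos_two_mul, Real.cos_sq']
      ring
    rw [div_pow, mul_pow, Real.sq_sqrt hst, hds, hs, hcos]
    field_simp
    ring
  rw [integral_congr hint, integral_eq_sub_of_hasDerivAt
    (f := fun t => s₀ * k / (σ ^ 2 * Real.cos (k * T) ^ 2) *
      (2 * k * t + Real.sin (2 * k * (T - t))))]
  · simp only [sub_self, mul_zero, Real.sin_zero, sub_zero]
    field_simp
    ring
  · intro t _
    have h := (hasDerivAt_id t).const_mul (2 * k)
    rw [mul_one] at h
    exact (h.add (hlin (2 * k) t).sin).const_mul _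
  · exact Continuous.intervalIntegrable (by fun_prop) _ _
end

section
/- Let s₀ > 0, σ > 0, T > 0, ψ > 0, and define s : [0,T] → ℝ by s(t) = s₀ · cosh²(√ψ(T−t)) / cosh²(√ψ T). Then: (i) s(t) > 0 on [0,T] and s(0) = s₀; (ii) ṡ(T) = 0; (iii) the function x(t) := √(s(t)) satisfies ẍ(t) − ψ·x(t) = 0 for all t ∈ [0,T], equivalently the CIR Euler–Lagrange equation 2 (d²/dt²)(√s) + 2φ√s = 0 with φ = −ψ; (iv) (1/T)∫₀ᵀ s(t) dt = (s₀/(2√ψ T)) · [ tanh(√ψ T) + √ψ T · sech²(√ψ T) ]; and (v) ∫₀ᵀ ( ṡ(t)/(σ√(s(t))) )² dt = (s₀√ψ/σ²) · [ sinh(2√ψ T) − 2√ψ T ] · sech²(√ψ T). -/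
open Real intervalIntegral

lemma hasDerivAt_cosh_mul_sub (k T t : ℝ) :
    HasDerivAt (fun u => Real.cosh (k * (T - u))) (-k * Real.sinh (k * (T - t))) t :=
  (((hasDerivAt_id' t).const_sub T).const_mul k).cosh.congr_deriv (by ring)

lemma hasDerivAt_sinh_mul_sub (k T t : ℝ) :
    HasDerivAt (fun u => Real.sinh (k * (T - u))) (-k * Real.cosh (k * (T - t))) t :=
  (((hasDerivAt_id' t).const_sub T).const_mul k).sinh.congr_deriv (by ring)

lemma integral_cosh_mul_sub_sq {k : ℝ} (hk : k ≠ 0) (T : ℝ) :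
    ∫ t in (0 : ℝ)..T, Real.cosh (k * (T - t)) ^ 2 =
      Real.sinh (k * T) * Real.cosh (k * T) / (2 * k) + T / 2 := by
  have hderiv : ∀ t ∈ Set.uIcc 0 T, HasDerivAt
      (fun u => u / 2 - Real.sinh (k * (T - u)) * Real.cosh (k * (T - u)) / (2 * k))
      (Real.cosh (k * (T - t)) ^ 2) t := fun t _ => by
    refine (((hasDerivAt_id' t).div_const 2).sub
      (((hasDerivAt_sinh_mul_sub k T t).mul (hasDerivAt_cosh_mul_sub k T t)).div_const
        (2 * k))).congr_deriv ?_
    field_simp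
    linarith [Real.cosh_sq (k * (T - t))]
  rw [integral_eq_sub_of_hasDerivAt hderiv
    (Continuous.intervalIntegrable (by fun_prop) _ _)]
  simp
  ring

lemma integral_sinh_mul_sub_sq {k : ℝ} (hk : k ≠ 0) (T : ℝ) :
    ∫ t in (0 : ℝ)..T, Real.sinh (k * (T - t)) ^ 2 =
      Real.sinh (k * T) * Real.cosh (k * T) / (2 * k) - T / 2 := by
  simp_rw [Real.sinh_sq]
  rw [integral_sub (Continuous.intervalIntegrable (by fun_prop) _ _) intervalIntegrable_const,
    integral_cosh_mul_sub_sq hk]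
  simp
  ring

/-- **The most-likely-path of the in-the-money Asian call in the CIR model**
`a(s,t) = σ√s`: the hyperbolic path `s(t) = s₀ cosh²(√ψ(T-t))/cosh²(√ψT)` is positive,
satisfies `s(0) = s₀` and `ṡ(T) = 0`, the function `x = √s` solves `ẍ - ψx = 0`
(the CIR Euler–Lagrange equation with `φ = -ψ`), the average equals
`(s₀/(2√ψT)) [tanh(√ψT) + √ψT sech²(√ψT)]`, and the action integral equals
`(s₀√ψ/σ²) [sinh(2√ψT) - 2√ψT] sech²(√ψT)`. -/
theorem cir_most_likely_path_itm (s₀ σ T ψ : ℝ) (hs₀ : 0 < s₀) (hσ : 0 < σ)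
    (hT : 0 < T) (hψ : 0 < ψ) (s : ℝ → ℝ)
    (hs : ∀ t, s t =
      s₀ * Real.cosh (Real.sqrt ψ * (T - t)) ^ 2 / Real.cosh (Real.sqrt ψ * T) ^ 2) :
    (∀ t ∈ Set.Icc (0 : ℝ) T, 0 < s t) ∧
    s 0 = s₀ ∧
    deriv s T = 0 ∧
    (∀ t ∈ Set.Icc (0 : ℝ) T,
      deriv (deriv fun u => Real.sqrt (s u)) t - ψ * Real.sqrt (s t) = 0) ∧
    (1 / T) * ∫ t in (0 : ℝ)..T, s t =
      s₀ / (2 * Real.sqrt ψ * T) *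
        (Real.tanh (Real.sqrt ψ * T) +
          Real.sqrt ψ * T * (1 / Real.cosh (Real.sqrt ψ * T)) ^ 2) ∧
    ∫ t in (0 : ℝ)..T, (deriv s t / (σ * Real.sqrt (s t))) ^ 2 =
      s₀ * Real.sqrt ψ / σ ^ 2 *
        (Real.sinh (2 * Real.sqrt ψ * T) - 2 * Real.sqrt ψ * T) *
        (1 / Real.cosh (Real.sqrt ψ * T)) ^ 2 := by
  have hk : 0 < Real.sqrt ψ := Real.sqrt_pos.mpr hψ
  have hkk : Real.sqrt ψ ^ 2 = ψ := Real.sq_sqrt hψ.le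
  set k := Real.sqrt ψ
  have hC : 0 < Real.cosh (k * T) := Real.cosh_pos _
  set C := Real.cosh (k * T) with hCdef
  have hr : 0 < Real.sqrt s₀ := Real.sqrt_pos.mpr hs₀
  have hrr : Real.sqrt s₀ ^ 2 = s₀ := Real.sq_sqrt hs₀.le
  set r := Real.sqrt s₀
  have hcosh : ∀ t, 0 < Real.cosh (k * (T - t)) := fun t => Real.cosh_pos _
  have hsqrt : ∀ t, Real.sqrt (s t) = r / C * Real.cosh (k * (T - t)) := fun t => by
    have := hcosh t
    rw [hs t, ← hrr, show r ^ 2 * Real.cosh (k * (T - t)) ^ 2 / C ^ 2 =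
      (r / C * Real.cosh (k * (T - t))) ^ 2 by ring]
    exact Real.sqrt_sq (by positivity)
  have hds : ∀ t, deriv s t =
      -(2 * k * s₀ / C ^ 2) * (Real.cosh (k * (T - t)) * Real.sinh (k * (T - t))) := fun t => by
    rw [funext hs]
    refine HasDerivAt.deriv (((((hasDerivAt_cosh_mul_sub k T t).fun_pow 2).const_mul
      s₀).div_const (C ^ 2)).congr_deriv ?_)
    push_cast
    ring
  refine ⟨fun t _ => ?_, ?_, ?_, fun t _ => ?_, ?_, ?_⟩
  · have := hcosh t
    rw [hs t]
    positivity
  · rw [hs 0, sub_zero, ← hCdef]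
    field_simp
  · simp [hds]
  · have hd : deriv (fun u => Real.sqrt (s u)) =
        fun u => r / C * (-k * Real.sinh (k * (T - u))) := by
      rw [funext hsqrt]
      exact funext fun u => ((hasDerivAt_cosh_mul_sub k T u).const_mul (r / C)).deriv
    rw [hd, (((hasDerivAt_sinh_mul_sub k T t).const_mul (-k)).const_mul (r / C)).deriv,
      hsqrt t, ← hkk]
    ring
  · have hint : ∫ t in (0 : ℝ)..T, s t =
        s₀ / C ^ 2 * (Real.sinh (k * T) * C / (2 * k) + T / 2) := by
      rw [← integral_cosh_mul_sub_sq hk.ne' T, ← integral_const_mul]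
      exact integral_congr fun t _ => by simp only [hs t]; ring
    rw [hint, Real.tanh_eq_sinh_div_cosh, ← hCdef]
    field_simp
  · have hint : ∫ t in (0 : ℝ)..T, (deriv s t / (σ * Real.sqrt (s t))) ^ 2 =
        4 * k ^ 2 * s₀ / (σ ^ 2 * C ^ 2) * (Real.sinh (k * T) * C / (2 * k) - T / 2) := by
      rw [← integral_sinh_mul_sub_sq hk.ne' T, ← integral_const_mul]
      refine integral_congr fun t _ => ?_
      have := hcosh t
      simp only [hds t, hsqrt t, ← hrr]
      field_simp
      ring
    rw [hint, mul_assoc 2 k T, Real.sinh_two_mul, ← hCdef]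
    field_simp
    ring
end

section
/- Let T > 0, s₀, K ∈ ℝ with K ≠ s₀, λ ∈ ℝ, and let a : ℝ × [0,T] → ℝ be continuously differentiable with a(x,t) > 0 for all x, t. Suppose s : [0,T] → ℝ is twice continuously differentiable and satisfies the Euler–Lagrange equation (d/dt)(ṡ(t)/a(s(t),t)) − (∂_t a(s(t),t)/a(s(t),t)²)·ṡ(t) + (λ/T)·a(s(t),t) = 0 for all t ∈ [0,T], together with s(0) = s₀, ṡ(T) = 0, and (1/T)∫₀ᵀ s(t) dt = K. Define ã(t) := a(s(t),t), f̃(t) := ∂_t a(s(t),t)/a(s(t),t), I(t) := ∫₀ᵗ ∫ᵣᵀ ã(r) ã(u) exp( −∫ᵣᵘ f̃(v) dv ) du dr, and Ī := (1/T)∫₀ᵀ I(u) du. Then Ī > 0 and s(t) = s₀ + (I(t)/Ī)·(K − s₀) for all t ∈ [0,T]. -/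
open Real intervalIntegral

/-- The partial derivative in the second variable of a `C¹` function is jointly continuous. -/
theorem continuous_deriv_snd {a : ℝ → ℝ → ℝ} (ha : ContDiff ℝ 1 fun p : ℝ × ℝ => a p.1 p.2) :
    Continuous fun p : ℝ × ℝ => deriv (fun τ => a p.1 τ) p.2 := by
  have h : (fun p : ℝ × ℝ => deriv (fun τ => a p.1 τ) p.2) =
      fun p => fderiv ℝ (fun p : ℝ × ℝ => a p.1 p.2) p (0, 1) := by
    ext ⟨x, t⟩
    have h1 := (ha.differentiable one_ne_zero (x, t)).hasFDerivAt
    have h2 : HasDerivAt (fun τ : ℝ => (x, τ)) ((0 : ℝ), (1 : ℝ)) t :=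
      (hasDerivAt_const t x).prodMk (hasDerivAt_id t)
    exact (h1.comp_hasDerivAt t h2).deriv
  rw [h]
  exact (ha.continuous_fderiv one_ne_zero).clm_apply continuous_const

/-- Variation of constants for the backward linear equation `y' = f y - c A`, `y(T) = 0`. -/
theorem eq_integral_of_linear_ode_backward {T c : ℝ} {A f y y' : ℝ → ℝ}
    (hA : Continuous A) (hf : Continuous f)
    (hy : ∀ t ∈ Set.Icc (0 : ℝ) T, HasDerivAt y (y' t) t)
    (hode : ∀ t ∈ Set.Icc (0 : ℝ) T, y' t - f t * y t + c * A t = 0) (hyT : y T = 0)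
    {r : ℝ} (hr : r ∈ Set.Icc (0 : ℝ) T) :
    y r = c * ∫ u in r..T, A u * Real.exp (-∫ v in r..u, f v) := by
  have hF : ∀ t, HasDerivAt (fun t => ∫ v in r..t, f v) (f t) t := fun t =>
    integral_hasDerivAt_right (hf.intervalIntegrable _ _)
      (hf.stronglyMeasurableAtFilter _ _) hf.continuousAt
  have hFc : Continuous fun t => ∫ v in r..t, f v :=
    continuous_iff_continuousAt.2 fun t => (hF t).continuousAt
  have hz : ∀ t ∈ Set.uIcc r T,
      HasDerivAt (fun t => y t * Real.exp (-∫ v in r..t, f v))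
        (-c * (A t * Real.exp (-∫ v in r..t, f v))) t := by
    intro t ht
    rw [Set.uIcc_of_le hr.2] at ht
    have ht' : t ∈ Set.Icc (0 : ℝ) T := ⟨hr.1.trans ht.1, ht.2⟩
    refine ((hy t ht').mul (hF t).neg.exp).congr_deriv ?_
    linear_combination Real.exp (-∫ v in r..t, f v) * hode t ht'
  have hint := integral_eq_sub_of_hasDerivAt hz
    ((continuous_const.mul (hA.mul hFc.neg.rexp)).intervalIntegrable _ _)
  rw [intervalIntegral.integral_const_mul] at hint
  simp only [hyT, zero_mul, integral_same, neg_zero, Real.exp_zero, mul_one] at hint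
  linarith

/-- The discounted integral kernel factors through a primitive of `f`, so it is continuous. -/
theorem continuous_integral_discounted {A f : ℝ → ℝ} (hA : Continuous A) (hf : Continuous f)
    (T : ℝ) :
    Continuous fun r => ∫ u in r..T, A r * A u * Real.exp (-∫ v in r..u, f v) := by
  have hFc : Continuous fun t => ∫ v in (0 : ℝ)..t, f v :=
    continuous_primitive (fun _ _ => hf.intervalIntegrable _ _) 0
  have hg : Continuous fun u => A u * Real.exp (-∫ v in (0 : ℝ)..u, f v) :=
    hA.mul hFc.neg.rexp
  have h : (fun r => ∫ u in r..T, A r * A u * Real.exp (-∫ v in r..u, f v)) = fun r =>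
      A r * Real.exp (∫ v in (0 : ℝ)..r, f v) *
        -∫ u in T..r, A u * Real.exp (-∫ v in (0 : ℝ)..u, f v) := by
    ext r
    rw [← integral_symm, ← intervalIntegral.integral_const_mul]
    congr 1
    ext u
    rw [← integral_interval_sub_left (hf.intervalIntegrable 0 u) (hf.intervalIntegrable 0 r),
      neg_sub, sub_eq_add_neg, Real.exp_add]
    ring
  rw [h]
  exact (hA.mul hFc.rexp).mul
    (continuous_primitive (fun _ _ => hg.intervalIntegrable _ _) T).neg

/-- **Fixed-point representation of the most-likely-path**: if `s` solves the
Euler–Lagrange equation `(d/dt)(ṡ/a(s,t)) - (∂ₜa(s,t)/a(s,t)²)ṡ + (λ/T)a(s,t) = 0`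
with `s(0) = s₀`, `ṡ(T) = 0` and `(1/T)∫₀ᵀ s = K`, then with
`ã(t) = a(s(t),t)`, `f̃(t) = ∂ₜa(s(t),t)/a(s(t),t)`,
`I(t) = ∫₀ᵗ∫ᵣᵀ ã(r)ã(u) e^{-∫ᵣᵘ f̃(v)dv} du dr` and `Ī = (1/T)∫₀ᵀ I(u) du`,
one has `Ī > 0` and `s(t) = s₀ + (I(t)/Ī)(K - s₀)` on `[0,T]`. -/
theorem most_likely_path_recursion (T s₀ K lam : ℝ) (hT : 0 < T) (hK : K ≠ s₀)
    (a : ℝ → ℝ → ℝ) (ha : ContDiff ℝ 1 fun p : ℝ × ℝ => a p.1 p.2)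
    (hapos : ∀ x t : ℝ, 0 < a x t)
    (s : ℝ → ℝ) (hs : ContDiff ℝ 2 s)
    (hEL : ∀ t ∈ Set.Icc (0 : ℝ) T,
      deriv (fun u => deriv s u / a (s u) u) t
        - deriv (fun τ => a (s t) τ) t / (a (s t) t) ^ 2 * deriv s t
        + lam / T * a (s t) t = 0)
    (hs0 : s 0 = s₀) (hsT : deriv s T = 0)
    (hsK : (1 / T) * ∫ t in (0 : ℝ)..T, s t = K)
    (atil ftil Ifun : ℝ → ℝ) (Ibar : ℝ)
    (hatil : ∀ t, atil t = a (s t) t)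
    (hftil : ∀ t, ftil t = deriv (fun τ => a (s t) τ) t / a (s t) t)
    (hIfun : ∀ t, Ifun t =
      ∫ r in (0 : ℝ)..t, ∫ u in r..T,
        atil r * atil u * Real.exp (-∫ v in r..u, ftil v))
    (hIbar : Ibar = (1 / T) * ∫ u in (0 : ℝ)..T, Ifun u) :
    0 < Ibar ∧ ∀ t ∈ Set.Icc (0 : ℝ) T, s t = s₀ + Ifun t / Ibar * (K - s₀) := by
  have hs1 : ContDiff ℝ 1 s := hs.of_le one_le_two
  have hds : ContDiff ℝ 1 (deriv s) := hs.deriv'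
  have hpath : ContDiff ℝ 1 fun t => a (s t) t := ha.comp (hs1.prodMk contDiff_id)
  have hA : Continuous atil := by
    rw [funext hatil]
    exact hpath.continuous
  have hAne : ∀ t, a (s t) t ≠ 0 := fun t => (hapos _ _).ne'
  have hf : Continuous ftil := by
    rw [funext hftil]
    exact ((continuous_deriv_snd ha).comp (hs.continuous.prodMk continuous_id)).div
      hpath.continuous hAne
  set w : ℝ → ℝ := fun r =>
    ∫ u in r..T, atil r * atil u * Real.exp (-∫ v in r..u, ftil v) with hw
  have hwc : Continuous w := continuous_integral_discounted hA hf T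
  have hwpos : ∀ r, r < T → 0 < w r := by
    intro r hr
    refine intervalIntegral_pos_of_pos (Continuous.intervalIntegrable ?_ _ _) (fun u => ?_) hr
    · exact (continuous_const.mul hA).mul
        (continuous_primitive (fun _ _ => hf.intervalIntegrable _ _) r).neg.rexp
    · rw [hatil, hatil]
      exact mul_pos (mul_pos (hapos _ _) (hapos _ _)) (Real.exp_pos _)
  have hIw : Ifun = fun t => ∫ r in (0 : ℝ)..t, w r := funext hIfun
  have hIc : Continuous Ifun := by
    rw [hIw]
    exact continuous_primitive (fun _ _ => hwc.intervalIntegrable _ _) 0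
  have hIpos : ∀ t ∈ Set.Ioo 0 T, 0 < Ifun t := by
    intro t ht
    rw [hIw]
    exact intervalIntegral_pos_of_pos_on (hwc.intervalIntegrable _ _)
      (fun r hr => hwpos r (hr.2.trans ht.2)) ht.1
  have hIbarpos : 0 < Ibar := by
    rw [hIbar]
    exact mul_pos (one_div_pos.2 hT)
      (intervalIntegral_pos_of_pos_on (hIc.intervalIntegrable _ _) hIpos hT)
  have hderiv : ∀ r ∈ Set.Icc (0 : ℝ) T, deriv s r = lam / T * w r := by
    intro r hr
    have hy : ∀ t ∈ Set.Icc (0 : ℝ) T, HasDerivAt (fun u => deriv s u / a (s u) u)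
        (deriv (fun u => deriv s u / a (s u) u) t) t := fun t _ =>
      ((hds.div hpath hAne).differentiable one_ne_zero t).hasDerivAt
    have hsol := eq_integral_of_linear_ode_backward (c := lam / T) hA hf hy
      (fun t ht => by
        rw [← hEL t ht, hftil, hatil]
        have := hAne t
        field_simp)
      (by simp [hsT]) hr
    rw [div_eq_iff (hAne r), ← hatil r] at hsol
    simp only [hw, mul_assoc, intervalIntegral.integral_const_mul]
    rw [hsol]
    ring
  have hsI : ∀ t ∈ Set.Icc (0 : ℝ) T, s t = s₀ + lam / T * Ifun t := by
    intro t ht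
    have h1 : ∫ r in (0 : ℝ)..t, deriv s r = s t - s 0 :=
      integral_deriv_eq_sub (fun r _ => hs1.differentiable one_ne_zero r)
        (hds.continuous.intervalIntegrable _ _)
    have h2 : ∫ r in (0 : ℝ)..t, deriv s r = lam / T * Ifun t := by
      rw [hIw, ← intervalIntegral.integral_const_mul]
      refine integral_congr fun r hr => ?_
      rw [Set.uIcc_of_le ht.1] at hr
      exact hderiv r ⟨hr.1, hr.2.trans ht.2⟩
    linarith
  have hKI : K - s₀ = lam / T * Ibar := by
    have h1 : ∫ t in (0 : ℝ)..T, s t = ∫ t in (0 : ℝ)..T, (s₀ + lam / T * Ifun t) :=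
      integral_congr fun t ht => hsI t (by rwa [Set.uIcc_of_le hT.le] at ht)
    rw [intervalIntegral.integral_add intervalIntegrable_const
      ((hIc.intervalIntegrable _ _).const_mul _), intervalIntegral.integral_const, intervalIntegral.integral_const_mul] at h1
    rw [← hsK, h1, hIbar, smul_eq_mul, sub_zero]
    field_simp
    ring
  refine ⟨hIbarpos, fun t ht => ?_⟩
  rw [hsI t ht, hKI]
  field_simp
end

section
/- Let n ≥ 1 and let a₁, …, aₙ be strictly positive real numbers. Let M be the n×n real symmetric tridiagonal matrix with diagonal entries M_{kk} = 2/a_k² for k = 1,…,n, off-diagonal entries M_{k,k+1} = M_{k+1,k} = −1/(a_k a_{k+1}) for k = 1,…,n−1, and all other entries zero. Then for every k with 1 ≤ k ≤ n, the k-th leading principal minor of M (the determinant of the top-left k×k submatrix) equals (k+1) · ∏_{j=1}^k a_j^{−2}. -/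
open Matrix BigOperators

/-- The second-difference matrix: `2` on the diagonal, `-1` next to it. -/
def secondDifferenceMatrix (R : Type*) [Ring R] (k : ℕ) : Matrix (Fin k) (Fin k) R :=
  Matrix.of fun i j =>
    if i = j then 2 else if (i : ℕ) + 1 = (j : ℕ) ∨ (j : ℕ) + 1 = (i : ℕ) then -1 else 0

theorem secondDifferenceMatrix_submatrix_succ (R : Type*) [Ring R] (k : ℕ) :
    (secondDifferenceMatrix R (k + 1)).submatrix Fin.succ Fin.succ =
      secondDifferenceMatrix R k := by
  ext i j
  simp [secondDifferenceMatrix]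

theorem det_secondDifferenceMatrix_add_two (R : Type*) [CommRing R] (k : ℕ) :
    (secondDifferenceMatrix R (k + 2)).det =
      2 * (secondDifferenceMatrix R (k + 1)).det - (secondDifferenceMatrix R k).det := by
  have h : ((secondDifferenceMatrix R (k + 2)).submatrix Fin.succ
      (Fin.succAbove 1)).det = -(secondDifferenceMatrix R k).det := by
    rw [det_succ_column_zero, Fin.sum_univ_succ, Finset.sum_eq_zero]
    · have hs : ((secondDifferenceMatrix R (k + 2)).submatrix Fin.succ
          (Fin.succAbove 1)).submatrix (Fin.succAbove 0) Fin.succ =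
          secondDifferenceMatrix R k := by
        ext i j
        simp [secondDifferenceMatrix, Fin.ext_iff, Fin.succAbove, Fin.lt_def]
      rw [hs]
      simp [secondDifferenceMatrix, Fin.ext_iff, Fin.succAbove]
    · intro i _
      simp [secondDifferenceMatrix, Fin.ext_iff, Fin.succAbove]
  rw [det_succ_row_zero, Fin.sum_univ_succ, Fin.sum_univ_succ, Finset.sum_eq_zero]
  · rw [Fin.succAbove_zero, secondDifferenceMatrix_submatrix_succ, Fin.succ_zero_eq_one, h]
    simp [secondDifferenceMatrix, Fin.ext_iff]
    ring
  · intro i _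
    simp [secondDifferenceMatrix, Fin.ext_iff]

theorem det_secondDifferenceMatrix (R : Type*) [CommRing R] (k : ℕ) :
    (secondDifferenceMatrix R k).det = k + 1 := by
  induction k using Nat.twoStepInduction with
  | zero => simp
  | one => simp [secondDifferenceMatrix, one_add_one_eq_two]
  | more k h₀ h₁ =>
    rw [det_secondDifferenceMatrix_add_two, h₀, h₁]
    push_cast
    ring

/-- **Leading principal minors of the tridiagonal Hessian block** with diagonal entries
`2/aₖ²` and off-diagonal entries `-1/(aₖaₖ₊₁)`: the `k`-th leading principal minor
equals `(k+1)∏_{j=1}^k aⱼ⁻²`. -/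
theorem tridiagonal_hessian_leading_minors (n : ℕ) (hn : 1 ≤ n)
    (a : Fin n → ℝ) (ha : ∀ i, 0 < a i)
    (M : Matrix (Fin n) (Fin n) ℝ)
    (hM : ∀ i j : Fin n, M i j =
      if i = j then 2 / (a i) ^ 2
      else if (i : ℕ) + 1 = (j : ℕ) ∨ (j : ℕ) + 1 = (i : ℕ) then -(1 / (a i * a j))
      else 0) :
    ∀ k : ℕ, 1 ≤ k → ∀ hk : k ≤ n,
      (M.submatrix (Fin.castLE hk) (Fin.castLE hk)).det =
        (k + 1 : ℝ) * ∏ j : Fin k, ((a (Fin.castLE hk j)) ^ 2)⁻¹ := by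
  intro k _ hk
  have h : M.submatrix (Fin.castLE hk) (Fin.castLE hk) =
      diagonal (fun i => (a (Fin.castLE hk i))⁻¹) * secondDifferenceMatrix ℝ k *
        diagonal (fun i => (a (Fin.castLE hk i))⁻¹) := by
    ext i j
    rw [mul_diagonal, diagonal_mul, submatrix_apply, hM]
    simp only [secondDifferenceMatrix, of_apply, Fin.ext_iff, Fin.val_castLE]
    split_ifs with hij
    · obtain rfl := Fin.ext hij
      ring
    · ring
    · ring
  rw [h, det_mul, det_mul, det_diagonal, det_secondDifferenceMatrix, mul_comm, ← mul_assoc,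
    ← Finset.prod_mul_distrib, mul_comm]
  simp only [← mul_inv, sq]
end

section
/- Let n ≥ 1 and let a₁, …, aₙ be strictly positive real numbers. Let H be the n×n real symmetric tridiagonal matrix with diagonal entries H_{kk} = 2/a_k² for k = 1,…,n−1 and H_{nn} = 1/a_n², off-diagonal entries H_{k,k+1} = H_{k+1,k} = −1/(a_k a_{k+1}) for k = 1,…,n−1, and all other entries zero. Then det(H) = ∏_{k=1}^n a_k^{−2}, and H is positive definite. -/
open Matrix BigOperators

/-- The matrix of the increments `x k / a k - x (k - 1) / a (k - 1)` (with `x (-1) = 0`). -/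
noncomputable def scaledIncrement {n : ℕ} (a : Fin n → ℝ) : Matrix (Fin n) (Fin n) ℝ :=
  Matrix.of fun k i =>
    ((if k = i then 1 else 0) - (if (k : ℕ) = (i : ℕ) + 1 then 1 else 0)) * (a i)⁻¹

theorem scaledIncrement_apply {n : ℕ} (a : Fin n → ℝ) (k i : Fin n) :
    scaledIncrement a k i =
      ((if k = i then 1 else 0) - (if (k : ℕ) = (i : ℕ) + 1 then 1 else 0)) * (a i)⁻¹ :=
  rfl

theorem det_scaledIncrement {n : ℕ} (a : Fin n → ℝ) :
    (scaledIncrement a).det = ∏ k, (a k)⁻¹ := by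
  rw [Matrix.det_of_isLowerTriangular]
  · simp [scaledIncrement_apply]
  · intro i j hij
    have hij' : (i : ℕ) < j := hij
    rw [scaledIncrement_apply, if_neg (by lia), if_neg (by lia)]
    simp

theorem sum_scaledIncrement_mul {n : ℕ} (a f : Fin n → ℝ) (i : Fin n) :
    ∑ k, scaledIncrement a k i * f k =
      (f i - if h : (i : ℕ) + 1 < n then f ⟨i + 1, h⟩ else 0) * (a i)⁻¹ := by
  have hsucc : ∑ k : Fin n, (if (k : ℕ) = (i : ℕ) + 1 then f k else 0) =
      if h : (i : ℕ) + 1 < n then f ⟨i + 1, h⟩ else 0 := by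
    split_ifs with h
    · rw [Finset.sum_eq_single ⟨i + 1, h⟩]
      · simp
      · intro k _ hk
        exact if_neg fun hki => hk (Fin.ext hki)
      · simp
    · exact Finset.sum_eq_zero fun k _ => if_neg (by lia)
  rw [← hsucc]
  calc ∑ k, scaledIncrement a k i * f k
      = ∑ k, ((if k = i then f k else 0) - (if (k : ℕ) = (i : ℕ) + 1 then f k else 0)) *
          (a i)⁻¹ := by
        refine Finset.sum_congr rfl fun k _ => ?_
        rw [scaledIncrement_apply]
        split_ifs <;> ring
    _ = _ := by
        rw [← Finset.sum_mul, Finset.sum_sub_distrib]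
        simp

theorem scaledIncrement_transpose_mul_self_apply {n : ℕ} (a : Fin n → ℝ) (i j : Fin n) :
    ((scaledIncrement a)ᵀ * scaledIncrement a) i j =
      if i = j then (if (i : ℕ) = n - 1 then 1 / (a i) ^ 2 else 2 / (a i) ^ 2)
      else if (i : ℕ) + 1 = (j : ℕ) ∨ (j : ℕ) + 1 = (i : ℕ) then -(1 / (a i * a j))
      else 0 := by
  rw [Matrix.mul_apply]
  simp only [Matrix.transpose_apply]
  rw [sum_scaledIncrement_mul a (fun k => scaledIncrement a k j) i]
  simp only [scaledIncrement_apply, Fin.ext_iff, div_eq_mul_inv, mul_inv, pow_two]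
  have hi := i.isLt
  have hj := j.isLt
  rcases eq_or_ne i j with rfl | hij
  · split_ifs <;> first | lia | ring
  · have hij' : (i : ℕ) ≠ j := fun h => hij (Fin.ext h)
    split_ifs <;> first | lia | ring

/-- **Determinant and positive definiteness of the dominant Hessian part `H¹`** of the
discretely monitored Asian option optimization problem: the symmetric tridiagonal matrix
with diagonal `2/aₖ²` (for `k < n`), last diagonal entry `1/aₙ²`, and off-diagonal
entries `-1/(aₖaₖ₊₁)` has determinant `∏ₖ aₖ⁻²` and is positive definite. -/
theorem tridiagonal_hessian_det_posDef (n : ℕ) (hn : 1 ≤ n)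
    (a : Fin n → ℝ) (ha : ∀ i, 0 < a i)
    (H : Matrix (Fin n) (Fin n) ℝ)
    (hH : ∀ i j : Fin n, H i j =
      if i = j then (if (i : ℕ) = n - 1 then 1 / (a i) ^ 2 else 2 / (a i) ^ 2)
      else if (i : ℕ) + 1 = (j : ℕ) ∨ (j : ℕ) + 1 = (i : ℕ) then -(1 / (a i * a j))
      else 0) :
    H.det = ∏ k : Fin n, ((a k) ^ 2)⁻¹ ∧ H.PosDef := by
  have hfac : H = (scaledIncrement a)ᵀ * scaledIncrement a := by
    ext i j
    rw [hH, scaledIncrement_transpose_mul_self_apply]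
  have hdet : (scaledIncrement a).det ≠ 0 := by
    rw [det_scaledIncrement]
    exact Finset.prod_ne_zero_iff.mpr fun k _ => inv_ne_zero (ha k).ne'
  subst hfac
  constructor
  · rw [Matrix.det_mul, Matrix.det_transpose, det_scaledIncrement, ← Finset.prod_mul_distrib]
    exact Finset.prod_congr rfl fun k _ => by rw [pow_two, mul_inv]
  · rw [← Matrix.conjTranspose_eq_transpose_of_trivial]
    refine Matrix.PosDef.conjTranspose_mul_self _ (Matrix.mulVec_injective_iff_isUnit.mpr ?_)
    exact (Matrix.isUnit_iff_isUnit_det _).mpr hdet.isUnit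
end
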